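/- arXiv:math/0410212 — 3 statements merged into one kernel-verified Lean document; each statement's English description precedes it below -/
import Mathlib

section
/- Let k ≥ 2 and let (V_j)_{j ∈ ℕ} be a countable collection of proper closed subvarieties of ℂ^k, i.e. for each j there is a family S_j of entire functions ℂ^k → ℂ with V_j = {z ∈ ℂ^k : f(z) = 0 for all f ∈ S_j} and V_j ≠ ℂ^k. Then there exists a Fatou–Bieberbach domain Ω in ℂ^k with ⋃_{j=1}^∞ V_j ⊆ Ω. -/
open Metric Set Filter

noncomputable section

/-- A Fatou–Bieberbach domain in `ℂ^k`: an open set `Ω ≠ ℂ^k` which is the range of an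
injective entire map `ℂ^k → ℂ^k`. -/
def IsFBDomain {k : ℕ} (Ω : Set (EuclideanSpace ℂ (Fin k))) : Prop :=
  IsOpen Ω ∧ Ω ≠ Set.univ ∧
    ∃ F : EuclideanSpace ℂ (Fin k) → EuclideanSpace ℂ (Fin k),
      Differentiable ℂ F ∧ Function.Injective F ∧ Set.range F = Ω

namespace FB

set_option linter.unusedSectionVars false

open scoped Topology

section Foundations

variable {E : Type*} [NormedAddCommGroup E] [NormedSpace ℂ E]
variable {G : Type*} [NormedAddCommGroup G] [NormedSpace ℂ G]

/-- Cauchy estimate for the full derivative. -/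
theorem cauchy_fderiv {f : E → G} (hf : Differentiable ℂ f) {x : E} {r C : ℝ} (hr : 0 < r)
    (hC : ∀ y, ‖y - x‖ ≤ r → ‖f y‖ ≤ C) : ‖fderiv ℂ f x‖ ≤ C / r := by
  have hC0 : 0 ≤ C := (norm_nonneg _).trans (hC x (by simpa using hr.le))
  refine ContinuousLinearMap.opNorm_le_bound _ (by positivity) fun v => ?_
  by_cases hv : v = 0
  · simp [hv]
  have hv' : 0 < ‖v‖ := norm_pos_iff.2 hv
  have hline : ∀ ζ : ℂ, HasDerivAt (fun ζ : ℂ => x + ζ • v) v ζ := fun ζ => by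
    simpa using ((hasDerivAt_id ζ).smul_const v).const_add x
  have hφ : Differentiable ℂ (fun ζ : ℂ => f (x + ζ • v)) := fun ζ =>
    (hf _).comp ζ (hline ζ).differentiableAt
  have hd : deriv (fun ζ : ℂ => f (x + ζ • v)) 0 = fderiv ℂ f x v := by
    have h1 : HasFDerivAt f (fderiv ℂ f x) (x + (0 : ℂ) • v) := by
      simpa using (hf x).hasFDerivAt
    exact (h1.comp_hasDerivAt (0 : ℂ) (hline 0)).deriv
  have := Complex.norm_deriv_le_of_forall_mem_sphere_norm_le (c := 0) (R := r / ‖v‖) (C := C)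
    (by positivity) hφ.diffContOnCl (fun ζ hζ => hC _ (by
      have : ‖ζ‖ = r / ‖v‖ := by simpa using hζ
      simp [norm_smul, this, hv'.ne']))
  rw [hd] at this
  calc _ ≤ _ := this
    _ = C / r * ‖v‖ := by field_simp

/-- Weierstrass: uniform limits on balls of entire maps are entire. -/
theorem weierstrass [CompleteSpace G] {f : ℕ → E → G} {g : E → G}
    (hf : ∀ n, Differentiable ℂ (f n))
    (hg : ∀ ρ : ℝ, ∀ η > 0, ∃ N, ∀ n ≥ N, ∀ z, ‖z‖ ≤ ρ → ‖f n z - g z‖ ≤ η) :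
    Differentiable ℂ g := by
  have key : ∀ ρ : ℝ, ∀ η > 0, ∃ N, ∀ m ≥ N, ∀ n ≥ N, ∀ z, ‖z‖ ≤ ρ →
      ‖fderiv ℂ (f m) z - fderiv ℂ (f n) z‖ ≤ η := by
    intro ρ η hη
    obtain ⟨N, hN⟩ := hg (ρ + 1) (η / 2) (by positivity)
    refine ⟨N, fun m hm n hn z hz => ?_⟩
    rw [← fderiv_sub (hf m z) (hf n z)]
    have := cauchy_fderiv ((hf m).sub (hf n)) (x := z) (r := 1) (C := η) one_pos (fun y hy => by
      have hy' : ‖y‖ ≤ ρ + 1 := by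
        calc ‖y‖ = ‖z + (y - z)‖ := by simp
          _ ≤ ‖z‖ + ‖y - z‖ := norm_add_le _ _
          _ ≤ _ := by linarith
      calc ‖f m y - f n y‖ = ‖(f m y - g y) - (f n y - g y)‖ := by simp
        _ ≤ ‖f m y - g y‖ + ‖f n y - g y‖ := norm_sub_le _ _
        _ ≤ _ := by linarith [hN m hm y hy', hN n hn y hy'])
    simpa using this
  have hlim : ∀ z, ∃ L, Tendsto (fun n => fderiv ℂ (f n) z) atTop (𝓝 L) := by
    intro z
    apply cauchySeq_tendsto_of_complete
    rw [Metric.cauchySeq_iff]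
    intro ε hε
    obtain ⟨N, hN⟩ := key ‖z‖ (ε / 2) (by positivity)
    exact ⟨N, fun m hm n hn => by
      rw [dist_eq_norm]; linarith [hN m hm n hn z le_rfl]⟩
  choose g' hg' using hlim
  intro x
  refine (hasFDerivAt_of_tendstoUniformlyOn (𝕜 := ℂ) (f := f) (g := g) (g' := g') (x := x) (l := atTop)
    (s := Metric.ball 0 (‖x‖ + 1)) Metric.isOpen_ball
    (f' := fun n z => fderiv ℂ (f n) z) ?_ (fun n z _ => (hf n z).hasFDerivAt) ?_
    (by simp)).differentiableAt
  · refine UniformCauchySeqOn.tendstoUniformlyOn_of_tendsto ?_ (fun z _ => hg' z)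
    rw [Metric.uniformCauchySeqOn_iff]
    intro ε hε
    obtain ⟨N, hN⟩ := key (‖x‖ + 1) (ε / 2) (by positivity)
    exact ⟨N, fun m hm n hn z hz => by
      rw [dist_eq_norm]; linarith [hN m hm n hn z (by simpa using (Metric.mem_ball.1 hz).le)]⟩
  · intro z _
    rw [Metric.tendsto_atTop]
    intro ε hε
    obtain ⟨N, hN⟩ := hg ‖z‖ (ε / 2) (by positivity)
    exact ⟨N, fun n hn => by rw [dist_eq_norm]; linarith [hN n hn z le_rfl]⟩

theorem second_order {φ : ℂ → G} [CompleteSpace G] (hφ : Differentiable ℂ φ) {C : ℝ}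
    (hC : ∀ ζ, ‖ζ‖ ≤ 3 → ‖φ ζ‖ ≤ C) {t : ℂ} (ht : ‖t‖ ≤ 1) :
    ‖φ t - φ 0 - t • deriv φ 0‖ ≤ C * ‖t‖ * ‖t‖ := by
  have hφ' : Differentiable ℂ (deriv φ) := fun z =>
    (hφ.analyticAt z).deriv.differentiableAt
  have h1 : ∀ ζ : ℂ, ‖ζ‖ ≤ 2 → ‖deriv φ ζ‖ ≤ C := by
    intro ζ hζ
    have := Complex.norm_deriv_le_of_forall_mem_sphere_norm_le (c := ζ) (R := 1) (C := C)
      one_pos hφ.diffContOnCl (fun y hy => hC y (by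
        have h : ‖y - ζ‖ = 1 := by simpa [dist_eq_norm] using hy
        have := norm_add_le (y - ζ) ζ
        simp at this; linarith))
    simpa using this
  have h2 : ∀ ζ : ℂ, ‖ζ‖ ≤ 1 → ‖deriv (deriv φ) ζ‖ ≤ C := by
    intro ζ hζ
    have := Complex.norm_deriv_le_of_forall_mem_sphere_norm_le (c := ζ) (R := 1) (C := C)
      one_pos hφ'.diffContOnCl (fun y hy => h1 y (by
        have h : ‖y - ζ‖ = 1 := by simpa [dist_eq_norm] using hy
        have := norm_add_le (y - ζ) ζ
        simp at this; linarith))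
    simpa using this
  have hC0 : 0 ≤ C := (norm_nonneg _).trans (hC 0 (by simp))
  have h3 : ∀ ζ ∈ Metric.closedBall (0 : ℂ) ‖t‖, ‖deriv φ ζ - deriv φ 0‖ ≤ C * ‖t‖ := by
    intro ζ hζ
    have hζ' : ‖ζ‖ ≤ ‖t‖ := by simpa using hζ
    have := (convex_closedBall (0 : ℂ) 1).norm_image_sub_le_of_norm_deriv_le
      (f := deriv φ) (C := C) (fun z _ => hφ' z) (fun z hz => h2 z (by simpa using hz))
      (x := 0) (y := ζ) (by simp) (by simpa using hζ'.trans ht)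
    calc _ ≤ _ := this
      _ ≤ _ := by simp only [sub_zero]; gcongr
  have hd : ∀ z, HasDerivAt (fun ζ => φ ζ - ζ • deriv φ 0) (deriv φ z - deriv φ 0) z := fun z => by
    have h := (hφ z).hasDerivAt.sub ((hasDerivAt_id z).smul_const (deriv φ 0))
    rw [one_smul] at h
    exact h
  have := (convex_closedBall (0 : ℂ) ‖t‖).norm_image_sub_le_of_norm_hasDerivWithin_le
      (f := fun ζ => φ ζ - ζ • deriv φ 0) (C := C * ‖t‖) (fun z _ => (hd z).hasDerivWithinAt) h3
      (x := 0) (y := t) (by simp) (by simp)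
  simpa [sub_right_comm] using this

theorem bounded_on_ball [ProperSpace E] {f : E → G} (hf : Continuous f) (ρ : ℝ) :
    ∃ C, 0 ≤ C ∧ ∀ z, ‖z‖ ≤ ρ → ‖f z‖ ≤ C := by
  obtain ⟨C, hC⟩ := (isCompact_closedBall (0 : E) ρ).exists_bound_of_continuousOn hf.continuousOn
  exact ⟨max C 0, le_max_right _ _, fun z hz => (hC z (by simpa using hz)).trans (le_max_left _ _)⟩

/-- Directional derivatives of entire maps are entire. -/
theorem differentiable_dir [ProperSpace E] [CompleteSpace G] {f : E → G} (hf : Differentiable ℂ f)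
    (v : E) : Differentiable ℂ (fun z => fderiv ℂ f z v) := by
  refine weierstrass (f := fun (n : ℕ) z => ((n : ℂ) + 1) • (f (z + ((n : ℂ) + 1)⁻¹ • v) - f z)) ?_ ?_
  · intro n
    fun_prop
  · intro ρ η hη
    obtain ⟨C, hC0, hC⟩ := bounded_on_ball hf.continuous (ρ + 3 * ‖v‖)
    obtain ⟨N, hN⟩ := exists_nat_gt (C / η)
    refine ⟨N, fun n hn z hz => ?_⟩
    have hline : ∀ ζ : ℂ, HasDerivAt (fun ζ : ℂ => z + ζ • v) v ζ := fun ζ => by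
      simpa using ((hasDerivAt_id ζ).smul_const v).const_add z
    have hφ : Differentiable ℂ (fun ζ : ℂ => f (z + ζ • v)) := fun ζ =>
      (hf _).comp ζ (hline ζ).differentiableAt
    have hd : deriv (fun ζ : ℂ => f (z + ζ • v)) 0 = fderiv ℂ f z v := by
      have h1 : HasFDerivAt f (fderiv ℂ f z) (z + (0 : ℂ) • v) := by
        simpa using (hf z).hasFDerivAt
      exact (h1.comp_hasDerivAt (0 : ℂ) (hline 0)).deriv
    have hnorm : ‖((n : ℂ) + 1)‖ = n + 1 := by
      have : ((n : ℂ) + 1) = ((n + 1 : ℕ) : ℂ) := by push_cast; rfl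
      rw [this, Complex.norm_natCast]; push_cast; rfl
    have hn0 : ((n : ℂ) + 1) ≠ 0 := by
      rw [← norm_pos_iff, hnorm]; positivity
    have := second_order hφ (C := C) (t := ((n : ℂ) + 1)⁻¹) (fun ζ hζ => hC _ (by
      calc _ ≤ ‖z‖ + ‖ζ • v‖ := norm_add_le _ _
        _ ≤ ρ + 3 * ‖v‖ := by rw [norm_smul]; gcongr)) (by
        rw [norm_inv, hnorm]; apply inv_le_one_of_one_le₀; linarith [n.cast_nonneg (α := ℝ)])
    rw [hd, norm_inv, hnorm] at this
    have e : ((n : ℂ) + 1) • (f (z + ((n : ℂ) + 1)⁻¹ • v) - f z) - fderiv ℂ f z v =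
        ((n : ℂ) + 1) • (f (z + ((n : ℂ) + 1)⁻¹ • v) - f (z + (0 : ℂ) • v)
          - ((n : ℂ) + 1)⁻¹ • fderiv ℂ f z v) := by
      rw [smul_sub _ _ (_ • _), smul_inv_smul₀ hn0]; simp
    rw [e, norm_smul, hnorm]
    calc _ ≤ ((n : ℝ) + 1) * (C * (n + 1 : ℝ)⁻¹ * (n + 1 : ℝ)⁻¹) := by gcongr
      _ = C / (n + 1) := by field_simp
      _ ≤ η := by
        rw [div_le_iff₀ (by positivity)]
        rw [div_lt_iff₀ hη] at hN
        have : (N : ℝ) ≤ n := by exact_mod_cast hn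
        nlinarith

theorem lipschitz_on_ball [ProperSpace E] {f : E → G} (hf : Differentiable ℂ f) (ρ : ℝ) :
    ∃ L, 0 ≤ L ∧ ∀ x y, ‖x‖ ≤ ρ → ‖y‖ ≤ ρ → ‖f x - f y‖ ≤ L * ‖x - y‖ := by
  obtain ⟨C, hC0, hC⟩ := bounded_on_ball hf.continuous (ρ + 1)
  refine ⟨C, hC0, fun x y hx hy => ?_⟩
  refine (convex_closedBall (0 : E) ρ).norm_image_sub_le_of_norm_fderiv_le (𝕜 := ℂ)
    (fun z _ => hf z) (fun z hz => ?_) (by simpa using hy) (by simpa using hx)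
  have hz' : ‖z‖ ≤ ρ := by simpa using hz
  have := cauchy_fderiv hf (x := z) (r := 1) (C := C) one_pos (fun w hw => hC w (by
    have := norm_add_le (w - z) z
    simp at this; linarith))
  simpa using this

end Foundations

section Density

variable {E : Type*} [NormedAddCommGroup E] [NormedSpace ℂ E] [FiniteDimensional ℂ E]

/-- The exponential of a linear form, as a continuous map. -/
def expMap (l : E →L[ℂ] ℂ) : C(E, ℂ) := ⟨fun z => Complex.exp (l z), by fun_prop⟩

theorem expMap_apply (l : E →L[ℂ] ℂ) (z : E) : expMap l z = Complex.exp (l z) := rfl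

/-- The closed algebra generated by exponentials of linear forms. -/
def expAlg (E : Type*) [NormedAddCommGroup E] [NormedSpace ℂ E] [FiniteDimensional ℂ E] :
    Subalgebra ℂ C(E, ℂ) :=
  (Algebra.adjoin ℂ (Set.range (expMap (E := E)))).topologicalClosure

theorem adjoin_exp_eq_span :
    Subalgebra.toSubmodule (Algebra.adjoin ℂ (Set.range (expMap (E := E)))) =
      Submodule.span ℂ (Set.range (expMap (E := E))) := by
  apply Algebra.adjoin_eq_span_of_subset
  refine Set.Subset.trans ?_ Submodule.subset_span
  intro x hx
  refine Submonoid.closure_induction (motive := fun x _ => x ∈ Set.range (expMap (E := E)))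
    (fun x hx => hx) ⟨0, ?_⟩ ?_ hx
  · ext z; simp [expMap_apply]
  · rintro _ _ _ _ ⟨a, rfl⟩ ⟨b, rfl⟩
    exact ⟨a + b, by ext z; simp [expMap_apply, Complex.exp_add]⟩

theorem mem_expAlg_of_approx (h : C(E, ℂ))
    (H : ∀ ρ : ℝ, ∀ η > 0, ∃ g ∈ expAlg E, ∀ z, ‖z‖ ≤ ρ → ‖h z - g z‖ ≤ η) : h ∈ expAlg E := by
  have : ∀ n : ℕ, ∃ g ∈ expAlg E, ∀ z, ‖z‖ ≤ n → ‖h z - g z‖ ≤ 1 / ((n : ℝ) + 1) := fun n =>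
    H n _ (by positivity)
  choose g hg hgh using this
  have hcl : IsClosed (expAlg E : Set C(E, ℂ)) := Subalgebra.isClosed_topologicalClosure _
  refine hcl.mem_of_tendsto (b := atTop) (f := g) ?_ (Eventually.of_forall hg)
  rw [ContinuousMap.tendsto_iff_forall_isCompact_tendstoUniformlyOn]
  intro K hK
  rw [Metric.tendstoUniformlyOn_iff]
  intro ε hε
  obtain ⟨C, hC⟩ := hK.isBounded.exists_norm_le
  obtain ⟨N, hN⟩ := exists_nat_ge C
  filter_upwards [eventually_ge_atTop N,
    (tendsto_one_div_add_atTop_nhds_zero_nat (𝕜 := ℝ)).eventually (gt_mem_nhds hε)] with n hn hn' z hz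
  rw [dist_eq_norm]
  have : (N : ℝ) ≤ n := by exact_mod_cast hn
  exact (hgh n z (((hC z hz).trans hN).trans this)).trans_lt hn'

theorem approx_of_mem_expAlg {h : C(E, ℂ)} (hh : h ∈ expAlg E) (ρ : ℝ) {η : ℝ} (hη : 0 < η) :
    ∃ g ∈ Submodule.span ℂ (Set.range (expMap (E := E))), ∀ z, ‖z‖ ≤ ρ → ‖h z - g z‖ ≤ η := by
  have hh' : h ∈ closure ((Algebra.adjoin ℂ (Set.range (expMap (E := E)))) : Set C(E, ℂ)) := hh
  have h1 := ContinuousMap.tendsto_iff_forall_isCompact_tendstoUniformlyOn.mp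
    (tendsto_id (α := C(E, ℂ)) (x := 𝓝 h)) (Metric.closedBall 0 ρ) (isCompact_closedBall _ _)
  rw [Metric.tendstoUniformlyOn_iff] at h1
  obtain ⟨g, hg1, hg2⟩ := (mem_closure_iff_nhds.1 hh') _ (h1 η hη)
  refine ⟨g, ?_, fun z hz => ?_⟩
  · rw [← adjoin_exp_eq_span]; exact hg2
  · have := hg1 z (by simpa using hz)
    rw [dist_eq_norm] at this
    exact this.le

theorem linear_mem_expAlg (l : E →L[ℂ] ℂ) : (⟨l, l.continuous⟩ : C(E, ℂ)) ∈ expAlg E := by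
  apply mem_expAlg_of_approx
  intro ρ η hη
  set B := ‖l‖ * |ρ| with hB
  have hB0 : 0 ≤ B := by positivity
  obtain ⟨n, hn⟩ := exists_nat_gt (max B (B ^ 2 / η))
  have hnB : B < n := (le_max_left _ _).trans_lt hn
  have hnB2 : B ^ 2 / η < n := (le_max_right _ _).trans_lt hn
  have hn0 : (0 : ℝ) < n := hB0.trans_lt hnB
  have hnc : (n : ℂ) ≠ 0 := by exact_mod_cast hn0.ne'
  refine ⟨(n : ℂ) • (expMap ((n : ℂ)⁻¹ • l) - 1), ?_, fun z hz => ?_⟩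
  · refine Subalgebra.smul_mem _ (Subalgebra.sub_mem _ ?_ (Subalgebra.one_mem _)) _
    exact Subalgebra.le_topologicalClosure _ (Algebra.subset_adjoin ⟨_, rfl⟩)
  · have hlz : ‖l z‖ ≤ B := (l.le_opNorm z).trans (by
      rw [hB]; gcongr; exact hz.trans (le_abs_self _))
    have hx : ‖(n : ℂ)⁻¹ * l z‖ ≤ B / n := by
      rw [norm_mul, norm_inv, Complex.norm_natCast, inv_mul_eq_div]; gcongr
    have h1 := Complex.norm_exp_sub_one_sub_id_le (x := (n : ℂ)⁻¹ * l z)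
      (hx.trans ((div_le_one hn0).2 hnB.le))
    have e : l z - (n : ℂ) * (Complex.exp ((n : ℂ)⁻¹ * l z) - 1) =
      -((n : ℂ) * (Complex.exp ((n : ℂ)⁻¹ * l z) - 1 - (n : ℂ)⁻¹ * l z)) := by
      field_simp; ring
    have e2 : ‖l z - (n : ℂ) * (Complex.exp ((n : ℂ)⁻¹ * l z) - 1)‖ ≤ η := by
      rw [e, norm_neg, norm_mul, Complex.norm_natCast]
      calc _ ≤ (n : ℝ) * (B / n) ^ 2 := by
            gcongr; exact h1.trans (by gcongr)
        _ = B ^ 2 / n := by field_simp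
        _ ≤ η := by
          rw [div_le_iff₀ hn0]; rw [div_lt_iff₀ hη] at hnB2; linarith
    simpa [expMap_apply] using e2

theorem line_deriv {f : E → ℂ} (hf : Differentiable ℂ f) (z : E) (ζ : ℂ) :
    HasDerivAt (fun ζ : ℂ => f (ζ • z)) (fderiv ℂ f (ζ • z) z) ζ := by
  have hline : HasDerivAt (fun ζ : ℂ => ζ • z) z ζ := by
    simpa using ((hasDerivAt_id ζ).smul_const z)
  exact (hf _).hasFDerivAt.comp_hasDerivAt ζ hline

theorem homog_mem (n : ℕ) : ∀ f : E → ℂ, Differentiable ℂ f →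
    ∃ g ∈ expAlg E, ∀ z, g z = iteratedDeriv n (fun ζ : ℂ => f (ζ • z)) 0 := by
  induction n with
  | zero =>
    intro f hf
    refine ⟨algebraMap ℂ C(E, ℂ) (f 0), Subalgebra.algebraMap_mem _ _, fun z => ?_⟩
    simp
  | succ n ih =>
    intro f hf
    let b := Module.finBasis ℂ E
    choose g hg hgz using fun i => ih (fun z => fderiv ℂ f z (b i)) (differentiable_dir hf (b i))
    refine ⟨∑ i, (⟨LinearMap.toContinuousLinearMap (b.coord i),
      (LinearMap.toContinuousLinearMap (b.coord i)).continuous⟩ : C(E, ℂ)) * g i,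
      Subalgebra.sum_mem _ fun i _ => Subalgebra.mul_mem _ (linear_mem_expAlg _) (hg i), fun z => ?_⟩
    rw [iteratedDeriv_succ']
    have hd : deriv (fun ζ : ℂ => f (ζ • z)) =
        fun ζ => ∑ i, b.repr z i * fderiv ℂ f (ζ • z) (b i) := by
      ext ζ
      rw [(line_deriv hf z ζ).deriv]
      conv_lhs => rw [← b.sum_repr z]
      rw [map_sum]
      refine Finset.sum_congr rfl fun i _ => ?_
      rw [map_smul, b.sum_repr z]; rfl
    rw [hd, iteratedDeriv_fun_sum]
    · simp only [ContinuousMap.coe_sum, Finset.sum_apply, ContinuousMap.coe_mul, Pi.mul_apply,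
        ContinuousMap.coe_mk]
      refine Finset.sum_congr rfl fun i _ => ?_
      rw [iteratedDeriv_const_mul_field, hgz]
      simp
    · intro i _
      have : Differentiable ℂ (fun ζ : ℂ => b.repr z i * fderiv ℂ f (ζ • z) (b i)) :=
        (fun ζ => ((line_deriv (differentiable_dir hf (b i)) z ζ).differentiableAt.const_mul _))
      exact this.contDiff.contDiffAt

theorem entire_mem_expAlg {f : E → ℂ} (hf : Differentiable ℂ f) :
    (⟨f, hf.continuous⟩ : C(E, ℂ)) ∈ expAlg E := by
  apply mem_expAlg_of_approx
  intro ρ η hη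
  choose g hg hgz using fun n => homog_mem n f hf
  obtain ⟨C, hC0, hC⟩ := bounded_on_ball hf.continuous (2 * |ρ|)
  have hφ : ∀ z, Differentiable ℂ (fun ζ : ℂ => f (ζ • z)) := fun z ζ =>
    (line_deriv hf z ζ).differentiableAt
  have hb : ∀ n : ℕ, ∀ z ∈ Metric.closedBall (0 : E) |ρ|,
      ‖((n.factorial : ℂ)⁻¹ * g n z)‖ ≤ C * (1 / 2) ^ n := by
    intro n z hz
    have hz' : ‖z‖ ≤ |ρ| := by simpa using hz
    have := Complex.norm_iteratedDeriv_le_of_forall_mem_sphere_norm_le (c := 0) (R := 2) (C := C) n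
      two_pos (hφ z).diffContOnCl (fun ζ hζ => hC _ (by
        have : ‖ζ‖ = 2 := by simpa using hζ
        rw [norm_smul, this]; gcongr))
    rw [hgz, norm_mul, norm_inv, Complex.norm_natCast]
    have hfac : (0 : ℝ) < n.factorial := by exact_mod_cast n.factorial_pos
    calc _ ≤ (n.factorial : ℝ)⁻¹ * (n.factorial * C / 2 ^ n) := by gcongr
      _ = _ := by rw [one_div_pow]; field_simp
  have hsum : Summable fun n : ℕ => C * (1 / 2 : ℝ) ^ n :=
    (summable_geometric_of_lt_one (by norm_num) (by norm_num)).mul_left C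
  have ht := tendstoUniformlyOn_tsum_nat hsum hb
  rw [Metric.tendstoUniformlyOn_iff] at ht
  obtain ⟨N, hN⟩ := (ht η hη).exists
  refine ⟨∑ n ∈ Finset.range N, (n.factorial : ℂ)⁻¹ • g n,
    Subalgebra.sum_mem _ fun n _ => Subalgebra.smul_mem _ (hg n) _, fun z hz => ?_⟩
  have h1 := hN z (by simpa using hz.trans (le_abs_self ρ))
  have h2 : ∑' n, ((n.factorial : ℂ)⁻¹ * g n z) = f z := by
    have := (Complex.hasSum_taylorSeries_of_entire (hφ z) 0 1).tsum_eq
    simp only [one_smul, sub_zero, one_pow, smul_eq_mul] at this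
    rw [← this]
    refine tsum_congr fun n => ?_
    rw [hgz, one_mul]
  rw [h2, dist_eq_norm] at h1
  simpa using h1.le

theorem density {f : E → ℂ} (hf : Differentiable ℂ f) (ρ : ℝ) {η : ℝ} (hη : 0 < η) :
    ∃ g ∈ Submodule.span ℂ (Set.range (expMap (E := E))), ∀ z, ‖z‖ ≤ ρ → ‖f z - g z‖ ≤ η :=
  approx_of_mem_expAlg (entire_mem_expAlg hf) ρ hη

end Density

section Automorphisms

variable {E : Type*} [NormedAddCommGroup E] [NormedSpace ℂ E]

/-- The group of holomorphic automorphisms. -/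
def autGroup (E : Type*) [NormedAddCommGroup E] [NormedSpace ℂ E] : Subgroup (Equiv.Perm E) where
  carrier := {e | Differentiable ℂ e ∧ Differentiable ℂ e.symm}
  mul_mem' := by
    rintro a b ⟨ha, ha'⟩ ⟨hb, hb'⟩
    exact ⟨ha.comp hb, hb'.comp ha'⟩
  one_mem' := ⟨differentiable_id, differentiable_id⟩
  inv_mem' := by
    rintro a ⟨ha, ha'⟩
    exact ⟨ha', ha⟩

/-- Vector fields which are approximable by one-parameter families of automorphisms. -/
def Good (X : E → E) : Prop :=
  Continuous X ∧ ∀ ρ : ℝ, ∀ η > 0, ∃ Ψ : ℂ → Equiv.Perm E, (∀ s, Ψ s ∈ autGroup E) ∧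
    ∃ s₀ > 0, ∀ s : ℂ, ‖s‖ ≤ s₀ → ∀ z, ‖z‖ ≤ ρ → ‖Ψ s z - z - s • X z‖ ≤ η * ‖s‖

theorem good_zero : Good (fun _ : E => (0 : E)) :=
  ⟨continuous_const, fun ρ η hη => ⟨fun _ => 1, fun _ => Subgroup.one_mem _, 1, one_pos,
    fun s _ z _ => by simp; positivity⟩⟩

theorem good_shear (c : ℂ) (l : E →L[ℂ] ℂ) (v : E) (hv : l v = 0) :
    Good (fun z => (c * Complex.exp (l z)) • v) := by
  refine ⟨by fun_prop, fun ρ η hη => ?_⟩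
  refine ⟨fun s => ⟨fun z => z + s • (c * Complex.exp (l z)) • v,
    fun z => z - s • (c * Complex.exp (l z)) • v, fun z => ?_, fun z => ?_⟩, fun s => ⟨?_, ?_⟩,
    1, one_pos, fun s _ z _ => ?_⟩
  · simp [hv]
  · simp [hv]
  · change Differentiable ℂ (fun z => z + s • (c * Complex.exp (l z)) • v)
    fun_prop
  · change Differentiable ℂ (fun z => z - s • (c * Complex.exp (l z)) • v)
    fun_prop
  · simp; positivity

theorem good_add [ProperSpace E] {X Y : E → E} (hX : Good X) (hY : Good Y) :
    Good (fun z => X z + Y z) := by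
  obtain ⟨hXc, hX⟩ := hX
  obtain ⟨hYc, hY⟩ := hY
  refine ⟨hXc.add hYc, fun ρ η hη => ?_⟩
  obtain ⟨Ψ₁, h₁, s₁, hs₁, H₁⟩ := hX ρ (η / 3) (by positivity)
  obtain ⟨Ψ₂, h₂, s₂, hs₂, H₂⟩ := hY (ρ + 1) (η / 3) (by positivity)
  obtain ⟨C, hC0, hC⟩ := bounded_on_ball hXc ρ
  have huc := (isCompact_closedBall (0 : E) (ρ + 1)).uniformContinuousOn_of_continuous
    hYc.continuousOn
  rw [Metric.uniformContinuousOn_iff] at huc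
  obtain ⟨δ, hδ, hδ'⟩ := huc (η / 3) (by positivity)
  set D := C + η / 3 + 1 with hD
  have hD0 : 0 < D := by positivity
  refine ⟨fun s => Ψ₂ s * Ψ₁ s, fun s => Subgroup.mul_mem _ (h₂ s) (h₁ s),
    min (min s₁ s₂) (min (1 / D) (δ / (2 * D))), by positivity, fun s hs z hz => ?_⟩
  have a1 : ‖s‖ ≤ s₁ := hs.trans ((min_le_left _ _).trans (min_le_left _ _))
  have a2 : ‖s‖ ≤ s₂ := hs.trans ((min_le_left _ _).trans (min_le_right _ _))
  have a3 : ‖s‖ * D ≤ 1 := by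
    rw [← le_div_iff₀ hD0]; exact hs.trans ((min_le_right _ _).trans (min_le_left _ _))
  have a4 : ‖s‖ * D < δ := by
    have : ‖s‖ ≤ δ / (2 * D) := hs.trans ((min_le_right _ _).trans (min_le_right _ _))
    rw [le_div_iff₀ (by positivity)] at this
    nlinarith
  have b1 := H₁ s a1 z hz
  have b2 : ‖Ψ₁ s z - z‖ ≤ ‖s‖ * D := by
    calc ‖Ψ₁ s z - z‖ = ‖(Ψ₁ s z - z - s • X z) + s • X z‖ := by simp
      _ ≤ η / 3 * ‖s‖ + ‖s‖ * C := (norm_add_le _ _).trans (by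
          rw [norm_smul]; gcongr; exact hC z hz)
      _ ≤ ‖s‖ * D := by rw [hD]; nlinarith [norm_nonneg s]
  have b3 : ‖Ψ₁ s z‖ ≤ ρ + 1 := by
    have := norm_add_le (Ψ₁ s z - z) z
    simp at this; linarith
  have b4 := H₂ s a2 (Ψ₁ s z) b3
  have b5 := hδ' (Ψ₁ s z) (by simpa using b3) z (by simpa using hz.trans (by linarith))
    (by rw [dist_eq_norm]; linarith)
  rw [dist_eq_norm] at b5
  have e : (Ψ₂ s * Ψ₁ s) z - z - s • (X z + Y z) =
      (Ψ₂ s (Ψ₁ s z) - Ψ₁ s z - s • Y (Ψ₁ s z)) + (Ψ₁ s z - z - s • X z)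
        + s • (Y (Ψ₁ s z) - Y z) := by
    simp only [Equiv.Perm.mul_apply, smul_add, smul_sub]; abel
  rw [e]
  refine (norm_add₃_le).trans ?_
  rw [norm_smul]
  nlinarith [norm_nonneg s]

theorem good_smul {X : E → E} (hX : Good X) (c : ℂ) : Good (fun z => c • X z) := by
  obtain ⟨hXc, hX⟩ := hX
  refine ⟨hXc.const_smul c, fun ρ η hη => ?_⟩
  obtain ⟨Ψ, h, s₀, hs₀, H⟩ := hX ρ (η / (‖c‖ + 1)) (by positivity)
  refine ⟨fun s => Ψ (s * c), fun s => h _, s₀ / (‖c‖ + 1), by positivity, fun s hs z hz => ?_⟩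
  rw [le_div_iff₀ (by positivity)] at hs
  have := H (s * c) (by rw [norm_mul]; nlinarith [norm_nonneg s]) z hz
  rw [mul_smul] at this
  refine this.trans ?_
  rw [norm_mul, div_mul_eq_mul_div, div_le_iff₀ (by positivity)]
  have : 0 ≤ η * ‖s‖ := by positivity
  nlinarith

theorem good_limit {X : E → E} (hX : Continuous X)
    (H : ∀ ρ : ℝ, ∀ η > 0, ∃ Y, Good Y ∧ ∀ z, ‖z‖ ≤ ρ → ‖X z - Y z‖ ≤ η) : Good X := by
  refine ⟨hX, fun ρ η hη => ?_⟩
  obtain ⟨Y, ⟨_, hY⟩, hXY⟩ := H ρ (η / 2) (by positivity)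
  obtain ⟨Ψ, h, s₀, hs₀, HH⟩ := hY ρ (η / 2) (by positivity)
  refine ⟨Ψ, h, s₀, hs₀, fun s hs z hz => ?_⟩
  have e : Ψ s z - z - s • X z = (Ψ s z - z - s • Y z) - s • (X z - Y z) := by
    rw [smul_sub]; abel
  rw [e]
  refine (norm_sub_le _ _).trans ?_
  rw [norm_smul]
  nlinarith [HH s hs z hz, hXY z hz, norm_nonneg s]

/-- The Hamiltonian vector field of `h` in the plane spanned by `u` and `w`. -/
def ham (u w : E) (h : E → ℂ) (z : E) : E := fderiv ℂ h z w • u - fderiv ℂ h z u • w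

theorem ham_differentiable [ProperSpace E] {u w : E} {h : E → ℂ} (hh : Differentiable ℂ h) :
    Differentiable ℂ (ham u w h) :=
  ((differentiable_dir hh w).smul_const u).sub ((differentiable_dir hh u).smul_const w)

theorem ham_norm_le (u w : E) (hu : ‖u‖ = 1) (hw : ‖w‖ = 1) (h : E → ℂ) (z : E) :
    ‖ham u w h z‖ ≤ 2 * ‖fderiv ℂ h z‖ := by
  refine (norm_sub_le _ _).trans ?_
  rw [norm_smul, norm_smul, hu, hw]
  have h1 := (fderiv ℂ h z).le_opNorm u
  have h2 := (fderiv ℂ h z).le_opNorm w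
  rw [hu] at h1
  rw [hw] at h2
  linarith

variable [FiniteDimensional ℂ E]

theorem good_ham_span {u w : E} {g : C(E, ℂ)}
    (hg : g ∈ Submodule.span ℂ (Set.range (expMap (E := E)))) :
    Differentiable ℂ g ∧ Good (ham u w g) := by
  induction hg using Submodule.span_induction with
  | mem x hx =>
    obtain ⟨l, rfl⟩ := hx
    have hd : ∀ z, HasFDerivAt (expMap l) (Complex.exp (l z) • l) z := fun z =>
      (l.hasFDerivAt (x := z)).cexp
    refine ⟨fun z => (hd z).differentiableAt, ?_⟩
    have e : ham u w (expMap l) = fun z => (1 * Complex.exp (l z)) • (l w • u - l u • w) := by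
      ext1 z
      rw [ham, (hd z).fderiv]
      simp [smul_sub, mul_smul]
    rw [e]
    refine good_shear _ _ _ ?_
    simp [mul_comm]
  | zero =>
    refine ⟨differentiable_const (0 : ℂ), ?_⟩
    have e : ham u w ((0 : C(E, ℂ)) : E → ℂ) = fun _ => 0 := by
      ext1 z
      have : fderiv ℂ ((0 : C(E, ℂ)) : E → ℂ) z = 0 := by
        rw [ContinuousMap.coe_zero]; simp
      rw [ham, this]; simp
    rw [e]; exact good_zero
  | add x y _ _ hx hy =>
    refine ⟨hx.1.add hy.1, ?_⟩
    have e : ham u w ((x + y : C(E, ℂ)) : E → ℂ) = fun z => ham u w x z + ham u w y z := by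
      ext1 z
      simp only [ham, ContinuousMap.coe_add, fderiv_add (hx.1 z) (hy.1 z), _root_.add_apply,
        add_smul]
      abel
    rw [e]; exact good_add hx.2 hy.2
  | smul c x _ hx =>
    refine ⟨hx.1.const_smul c, ?_⟩
    have e : ham u w ((c • x : C(E, ℂ)) : E → ℂ) = fun z => c • ham u w x z := by
      ext1 z
      simp only [ham, ContinuousMap.coe_smul, fderiv_const_smul (hx.1 z), smul_sub, smul_smul]
      simp
    rw [e]; exact good_smul hx.2 c

theorem good_ham {u w : E} (hu : ‖u‖ = 1) (hw : ‖w‖ = 1) {h : E → ℂ} (hh : Differentiable ℂ h) :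
    Good (ham u w h) := by
  refine good_limit (ham_differentiable hh).continuous fun ρ η hη => ?_
  obtain ⟨g, hg, hgh⟩ := density hh (ρ + 1) (η := η / 2) (by positivity)
  obtain ⟨hgd, hgood⟩ := good_ham_span (u := u) (w := w) hg
  refine ⟨_, hgood, fun z hz => ?_⟩
  have e : ham u w h z - ham u w g z = ham u w (h - g) z := by
    simp only [ham, fderiv_sub (hh z) (hgd z), _root_.sub_apply, sub_smul]
    abel
  rw [e]
  have := cauchy_fderiv (hh.sub hgd) (x := z) (r := 1) (C := η / 2) one_pos (fun y hy => hgh y (by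
    have := norm_add_le (y - z) z
    simp at this; linarith))
  linarith [ham_norm_le u w hu hw (h - g) z]

end Automorphisms

section OneStep

/-- Composition of the first `j` permutations of a sequence. -/
def iter {E : Type*} (Ψ : ℕ → Equiv.Perm E) : ℕ → Equiv.Perm E
  | 0 => 1
  | j + 1 => Ψ j * iter Ψ j

variable {E : Type*} [NormedAddCommGroup E]

theorem iter_mem [NormedSpace ℂ E] {Ψ : ℕ → Equiv.Perm E} (h : ∀ j, Ψ j ∈ autGroup E) (j : ℕ) :
    iter Ψ j ∈ autGroup E := by
  induction j with
  | zero => exact Subgroup.one_mem _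
  | succ j ih => exact Subgroup.mul_mem _ (h j) ih

theorem track_lip [NormedSpace ℂ E] {Ψ : ℕ → Equiv.Perm E} {s : ℕ → ℂ} {X : E → E} {L ρ η κ : ℝ}
    {N : ℕ} (hL0 : 0 ≤ L) (hη : 0 ≤ η) (hκ : 0 ≤ κ)
    (hL : ∀ x y, ‖x‖ ≤ ρ → ‖y‖ ≤ ρ → ‖X x - X y‖ ≤ L * ‖x - y‖)
    (hΨ : ∀ j, j < N → ∀ z, ‖z‖ ≤ ρ → ‖Ψ j z - z - s j • X z‖ ≤ η * κ)
    (hs : ∀ j, j < N → ‖s j‖ ≤ κ) {y : ℕ → E}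
    (hy : ∀ j, j < N → y (j + 1) = y j + s j • X (y j)) (hyρ : ∀ j, j ≤ N → ‖y j‖ ≤ ρ - 1)
    (hsmall : η * κ * N * (1 + L * κ) ^ N ≤ 1) :
    ∀ j, j ≤ N → ‖iter Ψ j (y 0) - y j‖ ≤ η * κ * j * (1 + L * κ) ^ j := by
  intro j
  have hq : 1 ≤ 1 + L * κ := by nlinarith [mul_nonneg hL0 hκ]
  induction j with
  | zero => intro _; simp [iter]
  | succ j ih =>
    intro hj
    have hjN : j < N := hj
    have ih := ih hjN.le
    set x := iter Ψ j (y 0) with hx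
    have h1 : ‖x - y j‖ ≤ 1 := by
      refine ih.trans (le_trans ?_ hsmall)
      have : (j : ℝ) ≤ N := by exact_mod_cast hjN.le
      gcongr
    have hyj := hyρ j hjN.le
    have hxρ : ‖x‖ ≤ ρ := by
      have := norm_add_le (x - y j) (y j)
      simp at this; linarith
    have h2 := hΨ j hjN x hxρ
    have h3 := hL x (y j) hxρ (by linarith)
    have e : iter Ψ (j + 1) (y 0) - y (j + 1) =
        (Ψ j x - x - s j • X x) + (x - y j) + s j • (X x - X (y j)) := by
      rw [hy j hjN, smul_sub]
      simp only [iter, Equiv.Perm.mul_apply, ← hx]; abel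
    rw [e]
    refine norm_add₃_le.trans ?_
    rw [norm_smul]
    have h4 : ‖s j‖ * ‖X x - X (y j)‖ ≤ κ * (L * ‖x - y j‖) := by
      gcongr
      exact hs j hjN
    have h5 : (1 : ℝ) ≤ (1 + L * κ) ^ (j + 1) := one_le_pow₀ hq
    have h6 : (1 + L * κ) * ‖x - y j‖ ≤ (1 + L * κ) * (η * κ * j * (1 + L * κ) ^ j) := by gcongr
    have h7 : η * κ * 1 ≤ η * κ * (1 + L * κ) ^ (j + 1) := by gcongr
    push_cast
    calc _ ≤ η * κ + (1 + L * κ) * ‖x - y j‖ := by linarith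
      _ ≤ η * κ * (1 + L * κ) ^ (j + 1) + (1 + L * κ) * (η * κ * j * (1 + L * κ) ^ j) := by linarith
      _ = _ := by ring

theorem track_small [NormedSpace ℂ E] {Ψ : ℕ → Equiv.Perm E} {s : ℕ → ℂ} {X : E → E}
    {ρ η κ δ R R' : ℝ}
    {N : ℕ} (hη : 0 ≤ η) (hκ : 0 ≤ κ) (hδ : 0 ≤ δ)
    (hΨ : ∀ j, j < N → ∀ z, ‖z‖ ≤ ρ → ‖Ψ j z - z - s j • X z‖ ≤ η * κ)
    (hs : ∀ j, j < N → ‖s j‖ ≤ κ) (hX : ∀ z, ‖z‖ ≤ R' → ‖X z‖ ≤ δ) (hR' : R' ≤ ρ)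
    (hsmall : N * (κ * (δ + η)) ≤ R' - R) {z : E} (hz : ‖z‖ ≤ R) :
    ∀ j, j ≤ N → ‖iter Ψ j z - z‖ ≤ j * (κ * (δ + η)) := by
  intro j
  induction j with
  | zero => intro _; simp [iter]
  | succ j ih =>
    intro hj
    have hjN : j < N := hj
    have ih := ih hjN.le
    set x := iter Ψ j z with hx
    have h1 : ‖x - z‖ ≤ R' - R := by
      refine ih.trans (le_trans ?_ hsmall)
      have : (j : ℝ) ≤ N := by exact_mod_cast hjN.le
      gcongr
    have hxR : ‖x‖ ≤ R' := by
      have := norm_add_le (x - z) z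
      simp at this; linarith
    have h2 := hΨ j hjN x (hxR.trans hR')
    have h3 : ‖s j • X x‖ ≤ κ * δ := by
      rw [norm_smul]
      gcongr
      · exact hs j hjN
      · exact hX x hxR
    have e : iter Ψ (j + 1) z - z = (Ψ j x - x - s j • X x) + (x - z) + s j • X x := by
      simp only [iter, Equiv.Perm.mul_apply, ← hx]; abel
    rw [e]
    refine norm_add₃_le.trans ?_
    push_cast
    linarith

/-- A ray on which an entire function of one variable has no zeros. -/
theorem exists_ray {g : ℂ → ℂ} (hg : Differentiable ℂ g) (h0 : g 0 ≠ 0) :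
    ∃ a : ℂ, ‖a‖ = 1 ∧ ∀ t : ℝ, 0 ≤ t → g (t * a) ≠ 0 := by
  have hc : {z | g z = 0}.Countable := by
    apply (HereditarilyLindelofSpace.isLindelof _).countable_of_isDiscrete
    have han : AnalyticOnNhd ℂ g Set.univ := fun z _ => hg.analyticAt z
    rcases han.eqOn_zero_or_eventually_ne_zero_of_preconnected isPreconnected_univ with h | h
    · exact absurd (h (Set.mem_univ 0)) h0
    · have := isDiscrete_of_codiscreteWithin (s := {z | g z = 0}) (U := Set.univ) h
      rwa [Set.inter_univ] at this
  have hc' : (Complex.arg '' {z | g z = 0}).Countable := hc.image _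
  obtain ⟨θ, hθ, hθ'⟩ := (hc'.dense_compl ℝ).exists_mem_open (isOpen_Ioo (a := (0 : ℝ)) (b := 1))
    ⟨1 / 2, by norm_num⟩
  refine ⟨Complex.exp (θ * Complex.I), Complex.norm_exp_ofReal_mul_I θ, fun t ht hz => ?_⟩
  rcases ht.eq_or_lt with rfl | ht
  · simp at hz; exact h0 hz
  · apply hθ
    refine ⟨_, hz, ?_⟩
    rw [Complex.exp_mul_I]
    have h1 := Real.pi_gt_three
    exact Complex.arg_mul_cos_add_sin_mul_I ht ⟨by linarith [hθ'.1], by linarith [hθ'.2]⟩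

end OneStep

section Step

theorem exists_field {E : Type*} [NormedAddCommGroup E] [NormedSpace ℂ E] [FiniteDimensional ℂ E]
    {F : E → ℂ} (hF : Differentiable ℂ F) {u w : E} (hu : ‖u‖ = 1) (hw : ‖w‖ = 1)
    (l : E →L[ℂ] ℂ) (hl : ‖l‖ ≤ 1) (hlu : l u = 0) (hlw : l w = 1) {R P δ : ℝ} (hRP : R < P)
    (hδ : 0 < δ) :
    ∃ h : E → ℂ, Differentiable ℂ h ∧ (∀ z, F z = 0 → ham u w h z = 0) ∧
      (∀ z, l z = P → ham u w h z = (F z * F z) • u) ∧ ∀ z, ‖z‖ ≤ R → ‖ham u w h z‖ ≤ δ := by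
  have : ProperSpace E := FiniteDimensional.proper ℂ E
  set R2 := (R + P) / 2 with hR2
  obtain ⟨C, hC0, hC⟩ := bounded_on_ball (f := fun z => (F z * F z) * (l z - P))
    (by have := hF.continuous; fun_prop) R2
  set r := R2 - R with hr
  have hr0 : 0 < r := by simp only [hr, hR2]; linarith
  set τ := δ * r / (2 * (C + 1)) with hτ
  have hτ0 : 0 < τ := by positivity
  obtain ⟨M, hM0, hM⟩ : ∃ M : ℝ, 0 ≤ M ∧ Real.exp (-(M * (P - R2))) ≤ τ := by
    have hd : 0 < P - R2 := by simp only [hR2]; linarith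
    refine ⟨max 0 (-Real.log τ / (P - R2)), le_max_left _ _, ?_⟩
    rw [← Real.exp_log hτ0]
    apply Real.exp_le_exp.2
    have := le_max_right 0 (-Real.log τ / (P - R2))
    rw [div_le_iff₀ hd] at this
    rw [Real.exp_log hτ0]
    linarith
  have hl1 : ∀ z, HasFDerivAt (fun z => l z - (P : ℂ)) l z := fun z => l.hasFDerivAt.sub_const _
  have he : ∀ z, HasFDerivAt (fun z => Complex.exp (M * (l z - P)))
      (Complex.exp (M * (l z - P)) • ((M : ℂ) • l)) z := fun z =>
    ((hl1 z).const_mul (M : ℂ)).cexp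
  have hFF : ∀ z, HasFDerivAt (fun z => F z * F z) (F z • fderiv ℂ F z + F z • fderiv ℂ F z) z :=
    fun z => (hF z).hasFDerivAt.mul (hF z).hasFDerivAt
  have hh := fun z => (hFF z).mul ((hl1 z).mul (he z))
  set h : E → ℂ := fun z => (F z * F z) * ((l z - P) * Complex.exp (M * (l z - P))) with hdef
  have hd : Differentiable ℂ h := fun z => (hh z).differentiableAt
  refine ⟨h, hd, fun z hz => ?_, fun z hz => ?_, fun z hz => ?_⟩
  · have : fderiv ℂ h z = 0 := by
      refine (hh z).fderiv.trans ?_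
      ext v
      simp [hz]
    simp [ham, this]
  · have : fderiv ℂ h z = (F z * F z) • l := by
      refine (hh z).fderiv.trans ?_
      ext v
      simp [hz]
    simp [ham, this, hlu, hlw]
  · refine (ham_norm_le u w hu hw h z).trans ?_
    have hb : ∀ y, ‖y - z‖ ≤ r → ‖h y‖ ≤ C * τ := by
      intro y hy
      have hyR : ‖y‖ ≤ R2 := by
        have := norm_add_le (y - z) z
        simp at this; linarith
      have h1 := hC y hyR
      have h2 : ‖Complex.exp (M * (l y - P))‖ ≤ τ := by
        rw [Complex.norm_exp]
        refine le_trans (Real.exp_le_exp.2 ?_) hM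
        have h3 : (l y).re ≤ R2 := by
          refine (Complex.re_le_norm _).trans ((l.le_opNorm y).trans ?_)
          nlinarith [norm_nonneg y, norm_nonneg l]
        simp
        nlinarith
      have : h y = ((F y * F y) * (l y - P)) * Complex.exp (M * (l y - P)) := by
        simp only [hdef]; ring
      rw [this, norm_mul]
      gcongr
    have := cauchy_fderiv hd hr0 hb
    have h4 : C * τ / r ≤ δ / 2 := by
      rw [div_le_iff₀ hr0, hτ]
      have : C * (δ * r / (2 * (C + 1))) = (δ * r / 2) * (C / (C + 1)) := by
        field_simp
      rw [this]
      have : C / (C + 1) ≤ 1 := by rw [div_le_one (by positivity)]; linarith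
      nlinarith [mul_pos hδ hr0]
    linarith

theorem flow_step {E : Type*} [NormedAddCommGroup E] [NormedSpace ℂ E] [ProperSpace E]
    {X : E → E} (hX : Good X) (hXd : Differentiable ℂ X) {p u : E} (hu : ‖u‖ = 1)
    {T c1 m δ R R' ρ0 : ℝ} (hT : 0 < T) (hc1 : 0 < c1) (hm : 0 < m)
    (hmR : m ≤ R' - R) (hδ0 : 0 ≤ δ) (hδ : T * c1 * (2 * δ) ≤ m)
    (hXδ : ∀ z, ‖z‖ ≤ R' → ‖X z‖ ≤ δ) (hR' : R' ≤ ‖p‖) (hρ0 : 0 ≤ ρ0)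
    {g : ℝ → ℂ} (hg : ∀ t, 0 ≤ t → t ≤ T → X (p + (t : ℂ) • u) = g t • u ∧ g t ≠ 0 ∧ ‖(g t)⁻¹‖ ≤ c1) :
    ∃ φ ∈ autGroup E, (∀ z, ‖z‖ ≤ R → ‖φ z - z‖ ≤ m) ∧
      (∀ z, ‖z‖ ≤ ρ0 → X z = 0 → ‖φ z - z‖ ≤ 1) ∧ ‖φ p - (p + (T : ℂ) • u)‖ ≤ 1 := by
  set c := T * c1 with hc
  have hc0 : 0 < c := by positivity
  set ρ := ‖p‖ + T + ρ0 + 1 with hρ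
  obtain ⟨L, hL0, hL⟩ := lipschitz_on_ball hXd ρ
  set η := min (m / (2 * c)) (Real.exp (-(L * c)) / c) with hη
  have hη0 : 0 < η := by
    have := Real.exp_pos (-(L * c))
    simp only [hη]; positivity
  obtain ⟨Ψ, hΨ, s₀, hs₀, hΨs⟩ := hX.2 ρ η hη0
  obtain ⟨N, hN⟩ := exists_nat_gt (c / s₀)
  have hN0 : (0 : ℝ) < N := lt_of_le_of_lt (by positivity) hN
  set κ := c / N with hκ
  have hκ0 : 0 < κ := by positivity
  have hκs : κ ≤ s₀ := by
    rw [hκ, div_le_iff₀ hN0]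
    rw [div_lt_iff₀ hs₀] at hN
    linarith
  have hNκ : N * κ = c := by rw [hκ]; field_simp
  set τ : ℕ → ℝ := fun j => j * (T / N) with hτ
  have hτ0 : ∀ j, 0 ≤ τ j := fun j => by simp only [hτ]; positivity
  have hτT : ∀ j, j ≤ N → τ j ≤ T := by
    intro j hj
    have : (j : ℝ) ≤ N := by exact_mod_cast hj
    simp only [hτ]
    calc (j : ℝ) * (T / N) ≤ N * (T / N) := by gcongr
      _ = T := by field_simp
  set s : ℕ → ℂ := fun j => ((T / N : ℝ) : ℂ) * (g (τ j))⁻¹ with hs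
  have hsκ : ∀ j, j < N → ‖s j‖ ≤ κ := by
    intro j hj
    have := (hg (τ j) (hτ0 j) (hτT j hj.le)).2.2
    simp only [hs]
    rw [norm_mul, Complex.norm_real, Real.norm_of_nonneg (by positivity)]
    calc _ ≤ T / N * c1 := by gcongr
      _ = κ := by rw [hκ, hc]; ring
  have hΨ' : ∀ j, j < N → ∀ z, ‖z‖ ≤ ρ → ‖Ψ (s j) z - z - s j • X z‖ ≤ η * κ := by
    intro j hj z hz
    refine (hΨs (s j) ((hsκ j hj).trans hκs) z hz).trans ?_
    have := hsκ j hj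
    gcongr
  have hsmall : η * κ * N * (1 + L * κ) ^ N ≤ 1 := by
    have h1 : (1 + L * κ) ^ N ≤ Real.exp (L * c) := by
      have : 1 + L * κ ≤ Real.exp (L * κ) := by linarith [Real.add_one_le_exp (L * κ)]
      calc (1 + L * κ) ^ N ≤ Real.exp (L * κ) ^ N := by gcongr
        _ = Real.exp (L * c) := by rw [← Real.exp_nat_mul, ← hNκ]; ring_nf
    have h2 : η ≤ Real.exp (-(L * c)) / c := min_le_right _ _
    calc η * κ * N * (1 + L * κ) ^ N = η * (N * κ) * (1 + L * κ) ^ N := by ring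
      _ ≤ Real.exp (-(L * c)) / c * c * Real.exp (L * c) := by rw [hNκ]; gcongr
      _ = 1 := by
        rw [div_mul_cancel₀ _ hc0.ne', ← Real.exp_add]; simp
  refine ⟨iter (fun j => Ψ (s j)) N, iter_mem (fun j => hΨ _) N, fun z hz => ?_, fun z hz hXz => ?_, ?_⟩
  · have h3 : N * (κ * (δ + η)) ≤ m := by
      have h2 : η ≤ m / (2 * c) := min_le_left _ _
      rw [le_div_iff₀ (by positivity)] at h2
      rw [← mul_assoc, hNκ]
      nlinarith
    exact (track_small hη0.le hκ0.le hδ0 hΨ' hsκ hXδ (by linarith) (h3.trans hmR) hz N le_rfl).trans h3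
  · have := track_lip (y := fun _ => z) hL0 hη0.le hκ0.le hL hΨ' hsκ (by simp [hXz])
      (fun _ _ => by linarith [norm_nonneg p]) hsmall N le_rfl
    exact this.trans hsmall
  · have := track_lip (y := fun j => p + ((τ j : ℝ) : ℂ) • u) hL0 hη0.le hκ0.le hL hΨ' hsκ ?_ ?_
      hsmall N le_rfl
    · have hTN : τ N = T := by simp only [hτ]; field_simp
      have h0 : τ 0 = 0 := by simp [hτ]
      simp only [hTN, h0] at this
      simp only [Complex.ofReal_zero, zero_smul, add_zero] at this
      exact this.trans hsmall
    · intro j hj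
      obtain ⟨h1, h2, -⟩ := hg (τ j) (hτ0 j) (hτT j hj.le)
      rw [h1, smul_smul]
      simp only [hs]
      rw [mul_assoc, inv_mul_cancel₀ h2, mul_one, add_assoc, ← add_smul]
      congr 2
      simp only [hτ]; push_cast; ring
    · intro j hj
      refine (norm_add_le _ _).trans ?_
      rw [norm_smul, hu, Complex.norm_real, Real.norm_of_nonneg (hτ0 j)]
      linarith [hτT j hj]

theorem one_step {E : Type*} [NormedAddCommGroup E] [InnerProductSpace ℂ E] [FiniteDimensional ℂ E]
    (hdim : 2 ≤ Module.finrank ℂ E) {F : E → ℂ} (hF : Differentiable ℂ F) {p : E} (hp : F p ≠ 0)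
    {R ε : ℝ} (hR0 : 0 ≤ R) (hR : R < ‖p‖) (hε : 0 < ε) {K : Set E} (hK : Bornology.IsBounded K)
    (hKF : ∀ z ∈ K, F z = 0) :
    ∃ φ ∈ autGroup E, ∃ R1 ≥ R + 1, (∀ z, ‖z‖ ≤ R → ‖φ z - z‖ ≤ ε) ∧
      (∀ z ∈ K, ‖φ z‖ ≤ R1) ∧ R1 < ‖φ p‖ := by
  have : ProperSpace E := FiniteDimensional.proper ℂ E
  have hp0 : 0 < ‖p‖ := lt_of_le_of_lt hR0 hR
  have hpn : (‖p‖ : ℂ) ≠ 0 := by exact_mod_cast hp0.ne'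
  obtain ⟨v, hv, hv0⟩ : ∃ v : E, inner ℂ p v = 0 ∧ v ≠ 0 := by
    have h1 : LinearMap.ker (innerSL ℂ p).toLinearMap ≠ ⊥ :=
      LinearMap.ker_ne_bot_of_finrank_lt (by rw [Module.finrank_self]; omega)
    obtain ⟨v, hv, hv0⟩ := Submodule.exists_mem_ne_zero_of_ne_bot h1
    exact ⟨v, by simpa using hv, hv0⟩
  have hvn : (‖v‖ : ℂ) ≠ 0 := by exact_mod_cast (norm_pos_iff.2 hv0).ne'
  set u0 : E := (‖v‖ : ℂ)⁻¹ • v with hu0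
  have hu0n : ‖u0‖ = 1 := by
    rw [hu0, norm_smul, norm_inv, Complex.norm_real, norm_norm, inv_mul_cancel₀ (norm_ne_zero_iff.2 hv0)]
  obtain ⟨a, ha, hray⟩ := exists_ray (g := fun ζ => F (p + ζ • u0)) (by fun_prop) (by simpa using hp)
  set u : E := a • u0 with hu
  have hun : ‖u‖ = 1 := by rw [hu, norm_smul, ha, hu0n, one_mul]
  set w : E := (‖p‖ : ℂ)⁻¹ • p with hw
  have hwn : ‖w‖ = 1 := by
    rw [hw, norm_smul, norm_inv, Complex.norm_real, norm_norm, inv_mul_cancel₀ hp0.ne']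
  have hpu : inner ℂ p u = 0 := by
    rw [hu, hu0, inner_smul_right, inner_smul_right, hv]; simp
  have hwu : inner ℂ w u = 0 := by
    rw [hw, inner_smul_left, hpu, mul_zero]
  have hwp : inner ℂ w p = (‖p‖ : ℂ) := by
    rw [hw, inner_smul_left, inner_self_eq_norm_sq_to_K]
    simp; field_simp
  have hww : inner ℂ w w = (1 : ℂ) := by
    rw [inner_self_eq_norm_sq_to_K, hwn]; simp
  have hray' : ∀ t : ℝ, 0 ≤ t → F (p + (t : ℂ) • u) ≠ 0 := by
    intro t ht
    have := hray t ht
    rwa [mul_smul] at this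
  obtain ⟨ρ1, hρ1⟩ := hK.exists_norm_le
  set ρ0 := max ρ1 (R + 1) with hρ0
  have hρ0R : R + 1 ≤ ρ0 := le_max_right _ _
  have hρ0K : ∀ z ∈ K, ‖z‖ ≤ ρ0 := fun z hz => (hρ1 z hz).trans (le_max_left _ _)
  set T := ρ0 + 3 with hT
  have hT0 : 0 < T := by linarith
  set g : ℝ → ℂ := fun t => F (p + (t : ℂ) • u) * F (p + (t : ℂ) • u) with hg
  obtain ⟨c1, hc1, hgc⟩ : ∃ c1 > 0, ∀ t ∈ Icc 0 T, ‖(g t)⁻¹‖ ≤ c1 := by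
    have hcont : ContinuousOn (fun t => (g t)⁻¹) (Icc 0 T) := by
      apply ContinuousOn.inv₀
      · have := hF.continuous
        apply Continuous.continuousOn
        simp only [hg]
        fun_prop
      · intro t ht
        exact mul_ne_zero (hray' t ht.1) (hray' t ht.1)
    obtain ⟨C, hC⟩ := isCompact_Icc.exists_bound_of_continuousOn hcont
    exact ⟨max C 1, by positivity, fun t ht => (hC t ht).trans (le_max_left _ _)⟩
  set R' := (R + ‖p‖) / 2 with hR'
  set m := min ε (R' - R) with hm
  have hm0 : 0 < m := by
    apply lt_min hε; simp only [hR']; linarith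
  set δ := m / (2 * (T * c1)) with hδ
  have hδ0 : 0 < δ := by positivity
  obtain ⟨h, hh, hzero, hline, hsmall⟩ := exists_field (F := F) hF (u := u) (w := w) hun hwn
    (innerSL ℂ w) (by rw [innerSL_apply_norm, hwn]) (by simpa using hwu) (by simpa using hww)
    (R := R') (P := ‖p‖) (δ := δ) (by simp only [hR']; linarith) hδ0
  obtain ⟨φ, hφ, h1, h2, h3⟩ := flow_step (good_ham hun hwn hh) (ham_differentiable hh) (p := p) (u := u) hun
    (T := T) (c1 := c1) (m := m) (δ := δ) (R := R) (R' := R') (ρ0 := ρ0) hT0 hc1 hm0 (min_le_right _ _)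
    hδ0.le (by rw [hδ]; apply le_of_eq; field_simp) hsmall (by simp only [hR']; linarith) (by linarith)
    (g := g) (fun t ht htT => ⟨hline _ (by
      rw [innerSL_apply_apply, inner_add_right, inner_smul_right, hwu, hwp]; simp),
      mul_ne_zero (hray' t ht) (hray' t ht), hgc t ⟨ht, htT⟩⟩)
  refine ⟨φ, hφ, ρ0 + 1, by linarith, fun z hz => (h1 z hz).trans (min_le_left _ _), fun z hz => ?_, ?_⟩
  · have h4 := h2 z (hρ0K z hz) (hzero z (hKF z hz))
    have := norm_add_le (φ z - z) z
    simp at this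
    linarith [hρ0K z hz]
  · have h5 : T ≤ ‖p + (T : ℂ) • u‖ := by
      have h6 := norm_inner_le_norm (𝕜 := ℂ) u (p + (T : ℂ) • u)
      have h7 : inner ℂ u p = 0 := inner_eq_zero_symm.1 hpu
      rw [inner_add_right, inner_smul_right, h7, inner_self_eq_norm_sq_to_K, hun] at h6
      simp at h6
      rwa [abs_of_pos hT0] at h6
    have h8 := norm_sub_norm_le (p + (T : ℂ) • u) (φ p)
    rw [norm_sub_rev] at h8
    linarith

end Step

section PushOut

theorem inverse_close {E : Type*} [NormedAddCommGroup E] [NormedSpace ℝ E] {φ : Equiv.Perm E}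
    (hφ : Continuous φ.symm) {R ε : ℝ} (hR : 3 ≤ R) (hε : ε ≤ 1 / 2)
    (h : ∀ x, ‖x‖ ≤ R → ‖φ x - x‖ ≤ ε) {x : E} (hx : ‖x‖ ≤ R - 1) :
    ‖φ.symm x - x‖ ≤ ε := by
  have key : ∀ y, ‖φ.symm y‖ ≤ R → ‖φ.symm y - y‖ ≤ ε := by
    intro y hy
    have := h _ hy
    rwa [Equiv.apply_symm_apply, norm_sub_rev] at this
  by_contra hcon
  have hxR : R < ‖φ.symm x‖ := by
    by_contra h'
    exact hcon (key x (not_lt.1 h'))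
  have hpc : IsPreconnected (closedBall (0 : E) (R - 1)) :=
    (convex_closedBall (0 : E) (R - 1)).isPreconnected
  have h0 := h 0 (by simp; linarith)
  have h0' : φ 0 ∈ closedBall (0 : E) (R - 1) := by
    rw [mem_closedBall_zero_iff]; simp at h0; linarith
  have := hpc.intermediate_value h0' (mem_closedBall_zero_iff.2 hx)
    (f := fun y => ‖φ.symm y‖) hφ.norm.continuousOn
  obtain ⟨y, hy, hyR⟩ := this (show R ∈ _ from ⟨by simp; linarith, hxR.le⟩)
  simp only at hyR
  have h1 := key y hyR.le
  rw [mem_closedBall_zero_iff] at hy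
  have := norm_add_le (φ.symm y - y) y
  simp at this
  linarith

theorem push_out {E : Type*} [NormedAddCommGroup E] [NormedSpace ℂ E] [ProperSpace E]
    {Φ : ℕ → Equiv.Perm E} (hΦ : ∀ n, Φ n ∈ autGroup E) {R : ℕ → ℝ} (hR0 : 3 ≤ R 0)
    (hR : ∀ n, R n + 1 ≤ R (n + 1))
    (hA : ∀ n z, ‖Φ n z‖ ≤ R n → ‖Φ (n + 1) z - Φ n z‖ ≤ (1 / 2) ^ (n + 1))
    (hB : ∀ n x, ‖x‖ ≤ R n - 1 → ‖Φ n ((Φ (n + 1)).symm x) - x‖ ≤ (1 / 2) ^ (n + 1))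
    (hC : ∀ n x, ‖x‖ ≤ R n - 1 → ‖(Φ (n + 1)).symm x - (Φ n).symm x‖ ≤ (1 / 2) ^ (n + 1)) :
    ∃ G : E → E, Differentiable ℂ G ∧ Function.Injective G ∧
      Set.range G = {z | ∃ n, ‖Φ n z‖ < R n} := by
  have hpow0 : ∀ n : ℕ, (0 : ℝ) < (1 / 2) ^ n := fun n => by positivity
  have hpow1 : ∀ n : ℕ, ((1 : ℝ) / 2) ^ n ≤ 1 := fun n => pow_le_one₀ (by norm_num) (by norm_num)
  have hpows : ∀ n : ℕ, ((1 : ℝ) / 2) ^ (n + 1) = (1 / 2) ^ n - (1 / 2) ^ (n + 1) := fun n => by ring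
  have hpt : Tendsto (fun n : ℕ => ((1 : ℝ) / 2) ^ n) atTop (𝓝 0) :=
    tendsto_pow_atTop_nhds_zero_of_lt_one (by norm_num) (by norm_num)
  have hRn : ∀ n : ℕ, (n : ℝ) + 3 ≤ R n := by
    intro n
    induction n with
    | zero => simpa using hR0
    | succ n ih => push_cast; linarith [hR n]
  have hRmono : Monotone R := monotone_nat_of_le_succ fun n => by linarith [hR n]
  have hlarge : ∀ ρ : ℝ, ∃ N : ℕ, ∀ n ≥ N, ρ ≤ R n - 2 := by
    intro ρ
    obtain ⟨N, hN⟩ := exists_nat_ge ρ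
    refine ⟨N, fun n hn => ?_⟩
    have : (N : ℝ) ≤ n := by exact_mod_cast hn
    linarith [hRn n]
  -- convergence from geometric telescoping
  have tel : ∀ (a : ℕ → E) (n : ℕ),
      (∀ m ≥ n, ‖a m - a n‖ ≤ (1 / 2) ^ n - (1 / 2) ^ m →
        ‖a (m + 1) - a m‖ ≤ (1 / 2) ^ (m + 1)) →
      ∀ m ≥ n, ‖a m - a n‖ ≤ (1 / 2) ^ n - (1 / 2) ^ m ∧ ‖a (m + 1) - a m‖ ≤ (1 / 2) ^ (m + 1) := by
    intro a n h m hm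
    have h1 : ‖a m - a n‖ ≤ (1 / 2) ^ n - (1 / 2) ^ m := by
      induction m, hm using Nat.le_induction with
      | base => simp
      | succ m hm ih =>
        have h2 := h m hm ih
        have h3 : a (m + 1) - a n = (a (m + 1) - a m) + (a m - a n) := by abel
        rw [h3]
        refine (norm_add_le _ _).trans ?_
        linarith [hpows m]
    exact ⟨h1, h m hm h1⟩
  have conv : ∀ (a : ℕ → E) (n : ℕ), (∀ m ≥ n, ‖a (m + 1) - a m‖ ≤ (1 / 2) ^ (m + 1)) →
      ∃ x, Tendsto a atTop (𝓝 x) := by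
    intro a n h
    have : CauchySeq (fun m => a (m + n)) := by
      apply cauchySeq_of_le_geometric (1 / 2) 1 (by norm_num)
      intro m
      rw [dist_eq_norm, norm_sub_rev]
      have := h (m + n) (by omega)
      rw [show m + 1 + n = m + n + 1 by omega]
      refine this.trans ?_
      rw [one_mul]
      exact pow_le_pow_of_le_one (by norm_num) (by norm_num) (by omega)
    obtain ⟨x, hx⟩ := cauchySeq_tendsto_of_complete this
    exact ⟨x, (tendsto_add_atTop_iff_nat n).1 hx⟩
  have hlim : ∀ x, ∃ y, Tendsto (fun m => (Φ m).symm x) atTop (𝓝 y) := by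
    intro x
    obtain ⟨N, hN⟩ := hlarge ‖x‖
    exact conv _ N fun m hm => hC m x (by linarith [hN m hm])
  choose G hG using hlim
  have hGn : ∀ n x, ‖x‖ ≤ R n - 1 → ‖(Φ n).symm x - G x‖ ≤ (1 / 2) ^ n := by
    intro n x hx
    have h1 := tel (fun m => (Φ m).symm x) n (fun m hm _ => hC m x (by linarith [hRmono hm]))
    have h2 : Tendsto (fun m => ‖(Φ m).symm x - (Φ n).symm x‖) atTop (𝓝 ‖G x - (Φ n).symm x‖) :=
      ((hG x).sub_const _).norm
    rw [norm_sub_rev]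
    refine le_of_tendsto h2 ?_
    filter_upwards [eventually_ge_atTop n] with m hm
    linarith [(h1 m hm).1, hpow0 m]
  have hGd : Differentiable ℂ G := by
    apply weierstrass (f := fun n => (Φ n).symm) (fun n => (hΦ n).2)
    intro ρ η hη
    obtain ⟨N, hN⟩ := hlarge ρ
    obtain ⟨N', hN'⟩ := eventually_atTop.1 (hpt.eventually_le_const hη)
    refine ⟨max N N', fun n hn z hz => (hGn n z ?_).trans (hN' n ?_)⟩
    · linarith [hN n (le_trans (le_max_left _ _) hn)]
    · exact le_trans (le_max_right _ _) hn
  have hQ : ∀ x d n, ‖x‖ ≤ R n - 2 →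
      ‖Φ n ((Φ (n + d)).symm x) - x‖ ≤ (1 / 2) ^ n - (1 / 2) ^ (n + d) := by
    intro x d
    induction d with
    | zero => intro n _; simp
    | succ d ih =>
      intro n hn
      have h1 := ih (n + 1) (by linarith [hR n])
      rw [show n + (d + 1) = n + 1 + d by omega]
      set y := Φ (n + 1) ((Φ (n + 1 + d)).symm x) with hy
      have hyn : ‖y‖ ≤ R n - 1 := by
        have := norm_add_le (y - x) x
        simp only [sub_add_cancel] at this
        linarith [hpow1 (n + 1), hpow0 (n + 1 + d)]
      have h2 := hB n y hyn
      rw [hy, Equiv.symm_apply_apply, ← hy] at h2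
      have h3 : Φ n ((Φ (n + 1 + d)).symm x) - x = (Φ n ((Φ (n + 1 + d)).symm x) - y) + (y - x) := by
        abel
      rw [h3]
      refine (norm_add_le _ _).trans ?_
      linarith [hpows n]
  have hQG : ∀ x n, ‖x‖ ≤ R n - 2 → ‖Φ n (G x) - x‖ ≤ (1 / 2) ^ n := by
    intro x n hx
    have h2 : Tendsto (fun m => ‖Φ n ((Φ m).symm x) - x‖) atTop (𝓝 ‖Φ n (G x) - x‖) :=
      ((((hΦ n).1.continuous.tendsto _).comp (hG x)).sub_const _).norm
    refine le_of_tendsto h2 ?_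
    filter_upwards [eventually_ge_atTop n] with m hm
    obtain ⟨d, rfl⟩ := Nat.exists_eq_add_of_le hm
    linarith [hQ x d n hx, hpow0 (n + d)]
  refine ⟨G, hGd, ?_, ?_⟩
  · intro x x' hxx
    have h1 : ∀ᶠ n in atTop, ‖x - x'‖ ≤ 2 * (1 / 2) ^ n := by
      obtain ⟨N, hN⟩ := hlarge ‖x‖
      obtain ⟨N', hN'⟩ := hlarge ‖x'‖
      filter_upwards [eventually_ge_atTop N, eventually_ge_atTop N'] with n hn hn'
      have h2 := hQG x n (hN n hn)
      have h3 := hQG x' n (hN' n hn')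
      rw [← hxx] at h3
      have h4 : x - x' = (Φ n (G x) - x') - (Φ n (G x) - x) := by abel
      rw [h4]
      refine (norm_sub_le _ _).trans ?_
      linarith
    have h2 : ‖x - x'‖ ≤ 2 * 0 := ge_of_tendsto (hpt.const_mul 2) h1
    rw [← sub_eq_zero, ← norm_le_zero_iff]
    linarith
  · ext z
    constructor
    · rintro ⟨x, rfl⟩
      obtain ⟨N, hN⟩ := hlarge ‖x‖
      refine ⟨N, ?_⟩
      have h1 := hQG x N (hN N le_rfl)
      have := norm_add_le (Φ N (G x) - x) x
      simp only [sub_add_cancel] at this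
      linarith [hpow1 N, hN N le_rfl]
    · rintro ⟨n, hn⟩
      have h1 := tel (fun m => Φ m z) n (fun m hm h => by
        apply hA
        rcases hm.eq_or_lt with rfl | hm
        · exact hn.le
        · have h2 : R (n + 1) ≤ R m := hRmono hm
          have := norm_add_le (Φ m z - Φ n z) (Φ n z)
          simp only [sub_add_cancel] at this
          linarith [hR n, hpow1 n, hpow0 m])
      obtain ⟨x, hx⟩ := conv (fun m => Φ m z) n fun m hm => (h1 m hm).2
      refine ⟨x, ?_⟩
      obtain ⟨N, hN⟩ := hlarge (R n + 1)
      have h3 : ∀ᶠ m in atTop, ‖z - G (Φ m z)‖ ≤ (1 / 2) ^ m := by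
        filter_upwards [eventually_ge_atTop N, eventually_ge_atTop n] with m hm hm'
        have := hGn m (Φ m z) (by
          have h4 := (h1 m hm').1
          have := norm_add_le (Φ m z - Φ n z) (Φ n z)
          simp only [sub_add_cancel] at this
          linarith [hpow1 n, hpow0 m, hN m hm])
        rwa [Equiv.symm_apply_apply] at this
      have h5 : Tendsto (fun m => ‖z - G (Φ m z)‖) atTop (𝓝 ‖z - G x‖) :=
        (((hGd.continuous.tendsto _).comp hx).const_sub z).norm
      have h6 := le_of_tendsto_of_tendsto h5 hpt h3
      rw [norm_le_zero_iff, sub_eq_zero] at h6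
      exact h6.symm

end PushOut

section Main

theorem dense_nonzero {E : Type*} [NormedAddCommGroup E] [NormedSpace ℂ E] {f : E → ℂ}
    (hf : Differentiable ℂ f) {q : E} (hq : f q ≠ 0) : Dense {z | f z ≠ 0} := by
  intro z
  by_contra hz
  rw [mem_closure_iff_frequently] at hz
  simp only [not_frequently, mem_setOf_eq, not_not] at hz
  set g : ℂ → ℂ := fun ζ => f (z + ζ • (q - z)) with hg
  have hgd : Differentiable ℂ g := by simp only [hg]; fun_prop
  have h0 : g =ᶠ[𝓝 0] 0 := by
    have : Tendsto (fun ζ : ℂ => z + ζ • (q - z)) (𝓝 0) (𝓝 z) := by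
      have : Continuous (fun ζ : ℂ => z + ζ • (q - z)) := by fun_prop
      simpa using this.tendsto 0
    exact this.eventually hz
  have := AnalyticOnNhd.eqOn_zero_of_preconnected_of_eventuallyEq_zero
    (fun ζ (_ : ζ ∈ Set.univ) => hgd.analyticAt ζ) isPreconnected_univ (mem_univ 0) h0 (mem_univ 1)
  apply hq
  simpa [hg] using this

theorem main {E : Type*} [NormedAddCommGroup E] [InnerProductSpace ℂ E] [FiniteDimensional ℂ E]
    (hdim : 2 ≤ Module.finrank ℂ E) {f : ℕ → E → ℂ} (hf : ∀ j, Differentiable ℂ (f j))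
    (hne : ∀ j, ∃ q, f j q ≠ 0) :
    ∃ G : E → E, Differentiable ℂ G ∧ Function.Injective G ∧ IsOpen (Set.range G) ∧
      Set.range G ≠ Set.univ ∧ ∀ j z, f j z = 0 → z ∈ Set.range G := by
  have : ProperSpace E := FiniteDimensional.proper ℂ E
  have : Nontrivial E := Module.nontrivial_of_finrank_pos (R := ℂ) (by omega)
  letI : NormedSpace ℝ E := NormedSpace.restrictScalars ℝ ℂ E
  obtain ⟨p, hp3, hp⟩ : ∃ p : E, 3 < ‖p‖ ∧ ∀ j, f j p ≠ 0 := by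
    have hd : Dense (⋂ j, {z | f j z ≠ 0}) := by
      apply dense_iInter_of_isOpen
      · intro j
        exact isOpen_ne_fun (hf j).continuous continuous_const
      · intro j
        obtain ⟨q, hq⟩ := hne j
        exact dense_nonzero (hf j) hq
    obtain ⟨x, hx⟩ := NormedSpace.exists_lt_norm ℂ E 3
    obtain ⟨p, hp1, hp2⟩ := hd.exists_mem_open (isOpen_lt continuous_const continuous_norm) ⟨x, hx⟩
    exact ⟨p, hp2, fun j => mem_iInter.1 hp1 j⟩
  set P : ℕ → E → ℂ := fun n z => ∏ j ∈ Finset.range (n + 1), f j z with hP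
  have hPd : ∀ n, Differentiable ℂ (P n) := by
    intro n
    simp only [hP]
    induction n with
    | zero => simpa using hf 0
    | succ n ih =>
      simp only [Finset.prod_range_succ _ (n + 1)]
      exact ih.mul (hf (n + 1))
  have hPp : ∀ n, P n p ≠ 0 := fun n => Finset.prod_ne_zero_iff.2 fun j _ => hp j
  let S := {s : Equiv.Perm E × ℝ // s.1 ∈ autGroup E ∧ 3 ≤ s.2 ∧ s.2 < ‖s.1 p‖}
  have step : ∀ (n : ℕ) (s : S), ∃ s' : S, s.1.2 + 1 ≤ s'.1.2 ∧
      (∀ z, ‖s.1.1 z‖ ≤ s.1.2 → ‖s'.1.1 z - s.1.1 z‖ ≤ (1 / 2) ^ (n + 1)) ∧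
      (∀ x, ‖x‖ ≤ s.1.2 - 1 → ‖s.1.1 (s'.1.1.symm x) - x‖ ≤ (1 / 2) ^ (n + 1)) ∧
      (∀ x, ‖x‖ ≤ s.1.2 - 1 → ‖s'.1.1.symm x - s.1.1.symm x‖ ≤ (1 / 2) ^ (n + 1)) ∧
      (∀ z, ‖z‖ ≤ n → P n z = 0 → ‖s'.1.1 z‖ ≤ s'.1.2) := by
    rintro n ⟨⟨Φ, R⟩, hΦ, hR3, hRp⟩
    simp only at hΦ hR3 hRp ⊢
    obtain ⟨L, hL0, hL⟩ := lipschitz_on_ball hΦ.2 R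
    set ε : ℝ := (1 / 2) ^ (n + 1) / (L + 1) with hε
    have hε0 : 0 < ε := by positivity
    have hεL : L * ε ≤ (1 / 2) ^ (n + 1) := by
      have : (L + 1) * ε = (1 / 2) ^ (n + 1) := by rw [hε]; field_simp
      linarith
    have hε1 : ε ≤ (1 / 2) ^ (n + 1) := div_le_self (by positivity) (by linarith)
    have hε2 : ε ≤ 1 / 2 := hε1.trans (by
      calc ((1 : ℝ) / 2) ^ (n + 1) ≤ (1 / 2) ^ 1 :=
            pow_le_pow_of_le_one (by norm_num) (by norm_num) (by omega)
        _ = 1 / 2 := by norm_num)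
    obtain ⟨φ, hφ, R1, hR1, h1, h2, h3⟩ := one_step hdim (F := fun x => P n (Φ.symm x))
      ((hPd n).comp hΦ.2) (p := Φ p) (by simpa using hPp n) (R := R) (ε := ε) (by linarith) hRp hε0
      (K := Φ '' (closedBall 0 n ∩ {z | P n z = 0}))
      ((((isCompact_closedBall (0 : E) (n : ℝ)).image hΦ.1.continuous).isBounded).subset
        (image_mono inter_subset_left))
      (by rintro _ ⟨z, ⟨-, hz⟩, rfl⟩; simpa using hz)
    have hinv := fun x hx => inverse_close hφ.2.continuous hR3 hε2 h1 (x := x) hx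
    refine ⟨⟨⟨φ * Φ, R1⟩, Subgroup.mul_mem _ hφ hΦ, by linarith, by simpa using h3⟩, ?_⟩
    simp only [Equiv.Perm.mul_apply]
    have hs : ∀ x, (φ * Φ).symm x = Φ.symm (φ.symm x) := fun x => rfl
    refine ⟨hR1, fun z hz => (h1 _ hz).trans hε1, fun x hx => ?_, fun x hx => ?_, fun z hz hz0 => ?_⟩
    · rw [hs, Equiv.apply_symm_apply]
      exact (hinv x hx).trans hε1
    · rw [hs]
      have h4 := hinv x hx
      have h5 := norm_add_le (φ.symm x - x) x
      simp only [sub_add_cancel] at h5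
      refine (hL _ _ (by linarith) (by linarith)).trans (le_trans ?_ hεL)
      gcongr
    · exact h2 _ ⟨z, ⟨by simpa using hz, hz0⟩, rfl⟩
  choose nxt hnxt using step
  let s0 : S := ⟨⟨1, 3⟩, Subgroup.one_mem _, le_rfl, by simpa using hp3⟩
  let sq : ℕ → S := fun n => Nat.rec s0 (fun n s => nxt n s) n
  have hsq : ∀ n, sq (n + 1) = nxt n (sq n) := fun n => rfl
  have hrel := fun n => hnxt n (sq n)
  simp only [← hsq] at hrel
  obtain ⟨G, hGd, hGi, hGr⟩ := push_out (Φ := fun n => (sq n).1.1) (fun n => (sq n).2.1)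
    (R := fun n => (sq n).1.2) (sq 0).2.2.1 (fun n => (hrel n).1) (fun n => (hrel n).2.1)
    (fun n => (hrel n).2.2.1) (fun n => (hrel n).2.2.2.1)
  refine ⟨G, hGd, hGi, ?_, ?_, ?_⟩
  · rw [hGr, setOf_exists]
    refine isOpen_iUnion fun n => ?_
    have := (sq n).2.1.1.continuous
    exact isOpen_lt this.norm continuous_const
  · intro h
    have : p ∈ Set.range G := h ▸ mem_univ p
    rw [hGr] at this
    obtain ⟨n, hn⟩ := this
    exact absurd hn (not_lt.2 (sq n).2.2.2.le)
  · intro j z hz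
    rw [hGr]
    obtain ⟨N, hN⟩ := exists_nat_ge ‖z‖
    set n := max j N with hn
    have hzn : ‖z‖ ≤ n := hN.trans (by exact_mod_cast le_max_right _ _)
    have hPz : P n z = 0 := Finset.prod_eq_zero (Finset.mem_range.2 (by omega)) hz
    have h1 := (hrel n).2.2.2.2 z hzn hPz
    have h2 := (hrel (n + 1)).2.1 z h1
    have h3 := (hrel (n + 1)).1
    refine ⟨n + 1 + 1, ?_⟩
    have h4 := norm_add_le ((sq (n + 1 + 1)).1.1 z - (sq (n + 1)).1.1 z) ((sq (n + 1)).1.1 z)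
    simp only [sub_add_cancel] at h4
    have h5 : ((1 : ℝ) / 2) ^ (n + 1 + 1) < 1 := pow_lt_one₀ (by norm_num) (by norm_num) (by omega)
    linarith

end Main

end FB

theorem FB_domain_containing_countably_many_subvarieties (k : ℕ) (hk : 2 ≤ k)
    (V : ℕ → Set (EuclideanSpace ℂ (Fin k)))
    (hV : ∀ j, ∃ S : Set (EuclideanSpace ℂ (Fin k) → ℂ),
      (∀ f ∈ S, Differentiable ℂ f) ∧
      V j = {z | ∀ f ∈ S, f z = 0} ∧ V j ≠ Set.univ) :
    ∃ Ω : Set (EuclideanSpace ℂ (Fin k)), IsFBDomain Ω ∧ (⋃ j, V j) ⊆ Ω := by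
  have h : ∀ j, ∃ f : EuclideanSpace ℂ (Fin k) → ℂ, Differentiable ℂ f ∧ (∃ q, f q ≠ 0) ∧
      ∀ z ∈ V j, f z = 0 := by
    intro j
    obtain ⟨S, hS, hVS, hne⟩ := hV j
    obtain ⟨q, hq⟩ := (Set.ne_univ_iff_exists_notMem _).1 hne
    rw [hVS] at hq
    simp only [Set.mem_setOf_eq, not_forall] at hq
    obtain ⟨f, hf, hfq⟩ := hq
    refine ⟨f, hS f hf, ⟨q, hfq⟩, fun z hz => ?_⟩
    rw [hVS] at hz
    exact hz f hf
  choose f hf hne hfV using h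
  obtain ⟨G, h1, h2, h3, h4, h5⟩ := FB.main (by simpa using hk) hf hne
  refine ⟨Set.range G, ⟨h3, h4, G, h1, h2, rfl⟩, ?_⟩
  exact Set.iUnion_subset fun j z hz => h5 j z (hfV j z hz)
end
end

section
/- Let k ≥ 2, let K ⊆ ℂ^k be a compact polynomially convex set, let V ⊆ ℂ^k be a closed subvariety (i.e. V = {z : f(z) = 0 for all f ∈ S} for some family S of entire functions ℂ^k → ℂ), and let K' ⊆ V be a compact set with K ∩ V ⊆ K'. Then the polynomially convex hull of K ∪ K' equals K ∪ K̂', where K̂' is the polynomially convex hull of K'. -/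
open Metric Set Filter

noncomputable section

/-- The polynomially convex hull of a set `K ⊆ ℂ^k`: the points `z` with
`|P(z)| ≤ sup_K |P|` for every polynomial `P`. -/
def polyHull (k : ℕ) (K : Set (EuclideanSpace ℂ (Fin k))) : Set (EuclideanSpace ℂ (Fin k)) :=
  {z | ∀ P : MvPolynomial (Fin k) ℂ,
    ‖MvPolynomial.eval (fun i => z i) P‖ ≤
      ⨆ w : K, ‖MvPolynomial.eval (fun i => (w : EuclideanSpace ℂ (Fin k)) i) P‖}

def polyAlg {X : Type*} [TopologicalSpace X] [CompactSpace X] {k : ℕ} (c : Fin k → C(X, ℂ)) :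
    Subalgebra ℂ C(X, ℂ) := (MvPolynomial.aeval c).range.topologicalClosure

lemma aeval_apply_eval {X : Type*} [TopologicalSpace X] [CompactSpace X] {k : ℕ}
    (c : Fin k → C(X, ℂ)) (P : MvPolynomial (Fin k) ℂ) (x : X) :
    (MvPolynomial.aeval c P) x = MvPolynomial.eval (fun i => c i x) P := by
  induction P using MvPolynomial.induction_on with
  | C a => simp
  | add p q hp hq => simp [hp, hq]
  | mul_X p i hp => simp [hp]

lemma summable_cauchy_aux {A : Type*} [NormedCommRing A] [NormedAlgebra ℂ A] [CompleteSpace A]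
    (h1 : ‖(1 : A)‖ ≤ 1) (G : ℂ → A) (b0 : A) :
    Summable (fun m => b0 ^ m * cauchyPowerSeries G 0 (‖b0‖ + 1) m (fun _ => 1)) := by
  set R : ℝ := ‖b0‖ + 1 with hRdef
  have hR : 0 < R := by positivity
  set C : ℝ := ((2 * Real.pi)⁻¹ * ∫ θ : ℝ in 0..2 * Real.pi, ‖G (circleMap 0 R θ)‖) with hC
  have hp : ∀ m, ‖b0 ^ m‖ ≤ ‖b0‖ ^ m := by
    intro m
    rcases Nat.eq_zero_or_pos m with rfl | hm
    · simpa using h1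
    · exact norm_pow_le' _ hm
  have ham : ∀ m, ‖cauchyPowerSeries G 0 R m (fun _ => 1)‖ ≤ C * R⁻¹ ^ m := by
    intro m
    refine (ContinuousMultilinearMap.le_opNorm _ _).trans ?_
    have := norm_cauchyPowerSeries_le G 0 R m
    rw [abs_of_pos hR] at this
    simp only [norm_one, Finset.prod_const_one, mul_one]
    exact this
  refine Summable.of_norm_bounded (g := fun m => C * (‖b0‖ / R) ^ m) ?_ ?_
  · apply Summable.mul_left
    apply summable_geometric_of_lt_one (by positivity)
    rw [div_lt_one hR]
    exact lt_add_one _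
  · intro m
    calc ‖b0 ^ m * cauchyPowerSeries G 0 R m (fun _ => 1)‖
        ≤ ‖b0 ^ m‖ * ‖cauchyPowerSeries G 0 R m (fun _ => 1)‖ := norm_mul_le _ _
      _ ≤ ‖b0‖ ^ m * (C * R⁻¹ ^ m) :=
        mul_le_mul (hp m) (ham m) (norm_nonneg _) (by positivity)
      _ = C * (‖b0‖ / R) ^ m := by rw [div_eq_mul_inv, mul_pow]; ring

set_option maxHeartbeats 1000000 in
lemma entire_mem_polyAlg {X : Type*} [TopologicalSpace X] [CompactSpace X] (k : ℕ) :
    ∀ (c : Fin k → C(X, ℂ)) (f : (Fin k → ℂ) → ℂ), Differentiable ℂ f →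
      ∀ F : C(X, ℂ), (∀ x, F x = f (fun i => c i x)) → F ∈ polyAlg c := by
  induction k with
  | zero =>
    intro c f hf F hF
    apply Subalgebra.le_topologicalClosure
    refine ⟨MvPolynomial.C (f 0), ?_⟩
    ext x
    simp only [RingHom.coe_coe, AlgHom.toRingHom_eq_coe]
    rw [aeval_apply_eval, hF]
    simp
    congr 1
    exact Subsingleton.elim _ _
  | succ k ih =>
    intro c f hf F hF
    set c' : Fin k → C(X, ℂ) := fun i => c i.succ with hc'
    have hle : polyAlg c' ≤ polyAlg c := by
      apply Subalgebra.topologicalClosure_mono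
      rintro _ ⟨P, rfl⟩
      refine ⟨MvPolynomial.rename Fin.succ P, ?_⟩
      simp only [RingHom.coe_coe, AlgHom.toRingHom_eq_coe]
      rw [MvPolynomial.aeval_rename]
      rfl
    have hc0 : c 0 ∈ polyAlg c := by
      apply Subalgebra.le_topologicalClosure
      exact ⟨MvPolynomial.X 0, by simp⟩
    have : CompleteSpace (polyAlg c) :=
      (Subalgebra.isClosed_topologicalClosure _).completeSpace_coe
    let A := polyAlg c
    -- the slices
    let Ψ : C(ℂ, C(X, ℂ)) := ContinuousMap.curry
      ⟨fun p : ℂ × X => f (Fin.cons p.1 (fun i => c' i p.2)), by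
        refine hf.continuous.comp ?_
        refine continuous_pi fun i => ?_
        refine Fin.cases ?_ (fun j => ?_) i
        · simpa using continuous_fst
        · simp only [Fin.cons_succ]; fun_prop⟩
    have hΨ : ∀ t x, Ψ t x = f (Fin.cons t (fun i => c' i x)) := fun t x => rfl
    have hcons : ∀ y : Fin k → ℂ, Differentiable ℂ (fun t : ℂ => (Fin.cons t y : Fin (k+1) → ℂ)) := by
      intro y
      rw [differentiable_pi]
      refine Fin.cases ?_ (fun j => ?_)
      · simp
      · simp
    have hcons' : ∀ t : ℂ, Differentiable ℂ (fun y : Fin k → ℂ => (Fin.cons t y : Fin (k+1) → ℂ)) := by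
      intro t
      rw [differentiable_pi]
      refine Fin.cases ?_ (fun j => ?_)
      · simp
      · simp only [Fin.cons_succ]; fun_prop
    have hΨA : ∀ t, Ψ t ∈ A := fun t =>
      hle (ih c' (fun y => f (Fin.cons t y)) (hf.comp (hcons' t)) _ (fun x => rfl))
    let G : ℂ → A := fun t => ⟨Ψ t, hΨA t⟩
    have hG : Continuous G := Ψ.continuous.subtype_mk _
    let b0 : A := ⟨c 0, hc0⟩
    let R : ℝ := ‖b0‖ + 1
    have hR : 0 < R := by positivity
    let a : ℕ → A := fun m => cauchyPowerSeries G 0 R m (fun _ => 1)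
    let ev : X → (A →L[ℂ] ℂ) := fun x =>
      (ContinuousMap.evalCLM ℂ x).comp A.toSubmodule.subtypeL
    have hev : ∀ x (b : A), ev x b = b.1 x := fun x b => rfl
    have ha : ∀ m x, ev x (a m) = cauchyPowerSeries (fun t => ev x (G t)) 0 R m (fun _ => 1) := by
      intro m x
      simp only [a, cauchyPowerSeries_apply, circleIntegral]
      rw [map_smul, ← ContinuousLinearMap.intervalIntegral_comp_comm]
      · simp
      · apply Continuous.intervalIntegrable
        have hne : ∀ θ, circleMap (0:ℂ) R θ ≠ 0 := fun θ => circleMap_ne_center hR.ne'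
        simp only [deriv_circleMap, sub_zero]
        have h1 : Continuous fun θ => G (circleMap 0 R θ) := hG.comp (continuous_circleMap 0 R)
        have h2 : Continuous fun θ => (circleMap (0:ℂ) R θ)⁻¹ :=
          (continuous_circleMap 0 R).inv₀ hne
        simp only [one_div]
        exact ((continuous_circleMap 0 R).mul continuous_const).smul
          ((h2.pow m).smul (h2.smul h1))
    have hna : Summable (fun m => b0 ^ m * a m) := by
      refine summable_cauchy_aux ?_ G b0
      change ‖(1 : C(X, ℂ))‖ ≤ 1
      rw [ContinuousMap.norm_le _ zero_le_one]
      simp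
    have hfin : F = ((∑' m, b0 ^ m * a m : A) : C(X, ℂ)) := by
      ext x
      have h1 : HasSum (fun m => ev x (b0 ^ m * a m)) (ev x (∑' m, b0 ^ m * a m)) :=
        (ev x).hasSum hna.hasSum
      have h2 : HasSum (fun m => ev x (b0 ^ m * a m)) (F x) := by
        set g : ℂ → ℂ := fun t => ev x (G t) with hg
        have hgd : Differentiable ℂ g := by
          change Differentiable ℂ (fun t => f (Fin.cons t (fun i => c' i x)))
          exact hf.comp (hcons _)
        have hx : ‖c 0 x‖ < R := by
          have : ‖c 0 x‖ ≤ ‖b0‖ := ContinuousMap.norm_coe_le_norm (c 0) x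
          exact this.trans_lt (lt_add_one _)
        have h3 := hasSum_cauchyPowerSeries_integral (f := g) (c := 0) (R := R) (w := c 0 x)
          (hgd.continuous.continuousOn.circleIntegrable hR.le) hx
        have h4 := (hgd.differentiableOn (s := closedBall 0 R)).circleIntegral_sub_inv_smul
          (w := c 0 x) (by simpa using hx)
        rw [zero_add, h4, smul_smul, inv_mul_cancel₀ Complex.two_pi_I_ne_zero, one_smul] at h3
        have h5 : g (c 0 x) = F x := by
          rw [hF]
          change f (Fin.cons (c 0 x) (fun i => c' i x)) = _
          congr 1
          ext i
          refine Fin.cases ?_ (fun j => ?_) i <;> simp [hc']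
        rw [h5] at h3
        suffices hs : (fun m => ev x (b0 ^ m * a m)) =
            fun m => cauchyPowerSeries g 0 R m fun _ => c 0 x by
          rw [hs]; exact h3
        funext m
        have h6 : ev x (b0 ^ m * a m) = (c 0 x) ^ m * ev x (a m) := by
          simp [hev, b0]
        rw [h6, ha, cauchyPowerSeries, ContinuousMultilinearMap.mkPiRing_apply,
          ContinuousMultilinearMap.mkPiRing_apply]
        simp
      exact h2.unique h1
    rw [hfin]
    exact (∑' m, b0 ^ m * a m : A).2

abbrev EE (k : ℕ) := EuclideanSpace ℂ (Fin k)

/-- coordinate functions on a subset -/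
def coordFn {k : ℕ} (X : Set (EE k)) : Fin k → C(X, ℂ) := fun i =>
  ⟨fun x => (x : EE k) i, by fun_prop⟩

/-- restriction of an entire function -/
def resFn {k : ℕ} (X : Set (EE k)) (f : EE k → ℂ) (hf : Differentiable ℂ f) : C(X, ℂ) :=
  ⟨fun x => f x, hf.continuous.comp continuous_subtype_val⟩

lemma resFn_mem {k : ℕ} (X : Set (EE k)) [CompactSpace X] (f : EE k → ℂ)
    (hf : Differentiable ℂ f) : resFn X f hf ∈ polyAlg (coordFn X) := by
  refine entire_mem_polyAlg k (coordFn X) (fun y => f (WithLp.toLp 2 y)) ?_ _ ?_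
  · exact hf.comp (PiLp.continuousLinearEquiv 2 ℂ (fun _ : Fin k => ℂ)).symm.differentiable
  · intro x; rfl

lemma differentiable_poly {k : ℕ} (P : MvPolynomial (Fin k) ℂ) :
    Differentiable ℂ (fun z : EE k => MvPolynomial.eval (fun i => z i) P) := by
  induction P using MvPolynomial.induction_on with
  | C a => simp
  | add p q hp hq => simp only [map_add]; exact hp.add hq
  | mul_X p i hp =>
    simp only [map_mul, MvPolynomial.eval_X]
    exact hp.mul (by fun_prop)

lemma exists_poly_approx {k : ℕ} (X : Set (EE k)) (hX : IsCompact X) (f : EE k → ℂ)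
    (hf : Differentiable ℂ f) (ε : ℝ) (hε : 0 < ε) :
    ∃ P : MvPolynomial (Fin k) ℂ, ∀ x ∈ X, ‖f x - MvPolynomial.eval (fun i => x i) P‖ < ε := by
  have : CompactSpace X := isCompact_iff_compactSpace.1 hX
  have h := resFn_mem X f hf
  have h' : resFn X f hf ∈ closure ((MvPolynomial.aeval (coordFn X)).range : Set C(X, ℂ)) := h
  rw [Metric.mem_closure_iff] at h'
  obtain ⟨_, ⟨P, rfl⟩, hP⟩ := h' ε hε
  refine ⟨P, fun x hx => ?_⟩
  have h1 := (ContinuousMap.dist_apply_le_dist (f := resFn X f hf)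
    (g := MvPolynomial.aeval (coordFn X) P) (⟨x, hx⟩ : X)).trans_lt hP
  rw [aeval_apply_eval, dist_eq_norm] at h1
  exact h1

lemma hull_entire {k : ℕ} (X : Set (EE k)) (hX : IsCompact X) (z : EE k) (hz : z ∈ polyHull k X)
    (f : EE k → ℂ) (hf : Differentiable ℂ f) (B : ℝ) (hB : 0 ≤ B) (hfB : ∀ x ∈ X, ‖f x‖ ≤ B) :
    ‖f z‖ ≤ B := by
  refine le_of_forall_pos_le_add fun ε hε => ?_
  obtain ⟨P, hP⟩ := exists_poly_approx (insert z X) (hX.insert z) f hf (ε / 2) (by positivity)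
  have h1 := hP z (mem_insert _ _)
  have h2 : ‖MvPolynomial.eval (fun i => z i) P‖ ≤ B + ε / 2 := by
    refine (hz P).trans (Real.iSup_le (fun w => ?_) (by positivity))
    have h3 := hP w (mem_insert_of_mem _ w.2)
    have h4 := norm_sub_norm_le (MvPolynomial.eval (fun i => (w : EE k) i) P) (f w)
    rw [norm_sub_rev] at h4
    linarith [hfB w w.2]
  have h5 := norm_sub_norm_le (f z) (MvPolynomial.eval (fun i => z i) P)
  linarith

lemma subset_polyHull {k : ℕ} (X : Set (EE k)) (hX : IsCompact X) : X ⊆ polyHull k X := by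
  intro z hz P
  have : BddAbove (range fun w : X => ‖MvPolynomial.eval (fun i => (w : EE k) i) P‖) := by
    have h := (hX.image (differentiable_poly P).continuous.norm).bddAbove
    refine h.mono ?_
    rintro _ ⟨w, rfl⟩
    exact ⟨w, w.2, rfl⟩
  exact le_ciSup this ⟨z, hz⟩

lemma polyHull_mono {k : ℕ} (X Y : Set (EE k)) (hY : IsCompact Y) (h : X ⊆ Y) :
    polyHull k X ⊆ polyHull k Y := by
  intro z hz P
  refine (hz P).trans (Real.iSup_le (fun w => subset_polyHull Y hY (h w.2) P) ?_)
  exact Real.iSup_nonneg fun _ => norm_nonneg _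

/-- Separation with normalisation. -/
lemma exists_sep {k : ℕ} (X : Set (EE k)) (hX : IsCompact X) (z : EE k) (hz : z ∉ polyHull k X) :
    ∃ (Q : MvPolynomial (Fin k) ℂ) (r : ℝ), 0 ≤ r ∧ r < 1 ∧
      MvPolynomial.eval (fun i => z i) Q = 1 ∧
      ∀ w ∈ X, ‖MvPolynomial.eval (fun i => w i) Q‖ ≤ r := by
  simp only [polyHull, Set.mem_ofPred_eq, not_forall, not_le] at hz
  obtain ⟨P, hP⟩ := hz
  set s := ⨆ w : X, ‖MvPolynomial.eval (fun i => (w : EE k) i) P‖ with hs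
  have hs0 : 0 ≤ s := Real.iSup_nonneg fun _ => norm_nonneg _
  set a := MvPolynomial.eval (fun i => z i) P with ha
  have ha0 : 0 < ‖a‖ := hs0.trans_lt hP
  have ha1 : a ≠ 0 := norm_pos_iff.1 ha0
  refine ⟨MvPolynomial.C a⁻¹ * P, s / ‖a‖, by positivity, (div_lt_one ha0).2 hP, ?_, ?_⟩
  · rw [map_mul, MvPolynomial.eval_C, ← ha, inv_mul_cancel₀ ha1]
  · intro w hw
    rw [map_mul, MvPolynomial.eval_C, norm_mul, norm_inv, div_eq_inv_mul]
    gcongr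
    exact subset_polyHull X hX hw P

lemma pow_small {A : Type*} [NormedCommRing A] [NormedAlgebra ℂ A] [CompleteSpace A] (a : A)
    (h : ∀ φ : WeakDual.characterSpace ℂ A, ‖φ a‖ < 1) :
    Tendsto (fun n : ℕ => ‖a ^ n‖) atTop (nhds 0) := by
  rcases subsingleton_or_nontrivial A with hA | hA
  · have : (fun n : ℕ => ‖a ^ n‖) = fun _ => 0 := by
      ext n; rw [Subsingleton.elim (a ^ n) 0, norm_zero]
    rw [this]; exact tendsto_const_nhds
  · have h1 : spectralRadius ℂ a < (1 : NNReal) := by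
      apply spectrum.spectralRadius_lt_of_forall_lt
      intro z hz
      obtain ⟨φ, rfl⟩ := WeakDual.CharacterSpace.mem_spectrum_iff_exists.1 hz
      exact h φ
    obtain ⟨ρ, hρ1, hρ2⟩ := ENNReal.lt_iff_exists_nnreal_btwn.1 h1
    have h2 := (spectrum.pow_nnnorm_pow_one_div_tendsto_nhds_spectralRadius a).eventually
      (gt_mem_nhds hρ1)
    have hρ : (ρ : ℝ) < 1 := by exact_mod_cast hρ2
    refine squeeze_zero' (Eventually.of_forall fun n => norm_nonneg _) ?_
      (tendsto_pow_atTop_nhds_zero_of_lt_one ρ.2 hρ)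
    filter_upwards [h2, eventually_gt_atTop 0] with n hn hn0
    have h3 : ((‖a ^ n‖₊ : ENNReal) ^ (1 / n : ℝ)) ^ (n : ℝ) ≤ (ρ : ENNReal) ^ (n : ℝ) :=
      ENNReal.rpow_le_rpow hn.le (by positivity)
    rw [← ENNReal.rpow_mul, one_div, inv_mul_cancel₀ (by positivity), ENNReal.rpow_one,
      ENNReal.rpow_natCast] at h3
    exact_mod_cast h3

lemma char_bound {A : Type*} [NormedCommRing A] [NormedAlgebra ℂ A] [CompleteSpace A]
    (h1 : ‖(1 : A)‖ ≤ 1) (ψ : A →ₐ[ℂ] ℂ) : (∀ a, ‖ψ a‖ ≤ ‖a‖) ∧ Continuous ψ := by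
  have h : ∀ a, ‖ψ a‖ ≤ ‖a‖ := fun a =>
    (AlgHom.norm_apply_le_self_mul_norm_one ψ a).trans
      (mul_le_of_le_one_right (norm_nonneg _) h1)
  refine ⟨h, ?_⟩
  exact AddMonoidHomClass.continuous_of_bound ψ 1 (fun a => by rw [one_mul]; exact h a)

lemma pow_quot {A : Type*} [NormedCommRing A] [NormedAlgebra ℂ A] [CompleteSpace A]
    (J : Ideal A) (hJ : IsClosed (J : Set A)) (a : A)
    (h : ∀ ψ : A →ₐ[ℂ] ℂ, (∀ j ∈ J, ψ j = 0) → ‖ψ a‖ < 1) (ε : ℝ) (hε : 0 < ε) :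
    ∃ n : ℕ, 0 < n ∧ ∃ r : A, a ^ n - r ∈ J ∧ ‖r‖ < ε := by
  have : CompleteSpace (A ⧸ J) := inferInstance
  have hlim := pow_small (Ideal.Quotient.mk J a) (fun φ => by
    let ψ : A →ₐ[ℂ] ℂ :=
      AlgHom.mk (((WeakDual.CharacterSpace.equivAlgHom φ : (A ⧸ J) →ₐ[ℂ] ℂ) :
        (A ⧸ J) →+* ℂ).comp (Ideal.Quotient.mk J))
        (fun x => (WeakDual.CharacterSpace.equivAlgHom φ).commutes x)
    refine h ψ fun j hj => ?_
    change φ (Ideal.Quotient.mk J j) = 0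
    rw [Ideal.Quotient.eq_zero_iff_mem.2 hj, map_zero])
  obtain ⟨n, hn, hn0⟩ := ((hlim.eventually (gt_mem_nhds hε)).and
    (eventually_gt_atTop 0)).exists
  rw [← map_pow] at hn
  obtain ⟨r, hr1, hr2⟩ := Ideal.Quotient.norm_mk_lt (I := J) (Ideal.Quotient.mk J (a ^ n))
    (ε := ε - ‖Ideal.Quotient.mk J (a ^ n)‖) (by linarith)
  refine ⟨n, hn0, r, ?_, by linarith⟩
  rw [← Ideal.Quotient.eq_zero_iff_mem, map_sub, hr1, sub_self]

set_option maxHeartbeats 1000000 in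
lemma key {k : ℕ} (K : Set (EE k)) (hK : IsCompact K) (hKpc : polyHull k K = K)
    (S : Set (EE k → ℂ)) (hS : ∀ f ∈ S, Differentiable ℂ f) (Q : MvPolynomial (Fin k) ℂ)
    (hQ : ∀ w ∈ K, (∀ f ∈ S, f w = 0) → ‖MvPolynomial.eval (fun i => w i) Q‖ < 1)
    (ε : ℝ) (hε : 0 < ε) :
    ∃ (n : ℕ) (g : EE k → ℂ), 0 < n ∧ Differentiable ℂ g ∧
      (∀ w, (∀ f ∈ S, f w = 0) → g w = 0) ∧
      ∀ x ∈ K, ‖MvPolynomial.eval (fun i => x i) Q ^ n - g x‖ < ε := by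
  have : CompactSpace K := isCompact_iff_compactSpace.1 hK
  let c := coordFn K
  let A := polyAlg c
  have hAc : CompleteSpace A :=
    (Subalgebra.isClosed_topologicalClosure _).completeSpace_coe
  let res : (f : EE k → ℂ) → Differentiable ℂ f → A := fun f hf => ⟨resFn K f hf, resFn_mem K f hf⟩
  let pol : MvPolynomial (Fin k) ℂ → A := fun P =>
    ⟨MvPolynomial.aeval c P, Subalgebra.le_topologicalClosure _ ⟨P, rfl⟩⟩
  have hpol : ∀ P (x : K), (pol P).1 x = MvPolynomial.eval (fun i => (x : EE k) i) P :=
    fun P x => aeval_apply_eval c P x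
  have hdense : ∀ a : A, a ∈ closure (range pol) := by
    intro a
    rw [Metric.mem_closure_iff]
    intro δ hδ
    have h' : a.1 ∈ closure ((MvPolynomial.aeval c).range : Set C(K, ℂ)) := a.2
    rw [Metric.mem_closure_iff] at h'
    obtain ⟨_, ⟨P, rfl⟩, hP⟩ := h' δ hδ
    exact ⟨pol P, ⟨P, rfl⟩, hP⟩
  let G : Set A := {a | ∃ (g : EE k → ℂ) (hg : Differentiable ℂ g),
      (∀ w, (∀ f ∈ S, f w = 0) → g w = 0) ∧ a = res g hg}
  let J : Ideal A :=
    { carrier := closure G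
      zero_mem' := subset_closure ⟨fun _ => 0, differentiable_const 0, fun _ _ => rfl, rfl⟩
      add_mem' := fun {a b} ha hb => by
        refine map_mem_closure₂ continuous_add ha hb ?_
        rintro _ ⟨g, hg, hg0, rfl⟩ _ ⟨h, hh, hh0, rfl⟩
        exact ⟨fun x => g x + h x, hg.add hh, fun w hw => by simp [hg0 w hw, hh0 w hw], rfl⟩
      smul_mem' := fun a b hb => by
        refine map_mem_closure₂ continuous_mul (hdense a) hb ?_
        rintro _ ⟨P, rfl⟩ _ ⟨h, hh, hh0, rfl⟩
        refine ⟨fun x => MvPolynomial.eval (fun i => x i) P * h x,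
          (differentiable_poly P).mul hh, fun w hw => by simp [hh0 w hw], ?_⟩
        apply Subtype.ext
        ext x
        exact congrArg (· * h x) (hpol P x) }
  have hJ : IsClosed (J : Set A) := isClosed_closure
  have hchar : ∀ ψ : A →ₐ[ℂ] ℂ, (∀ j ∈ J, ψ j = 0) → ‖ψ (pol Q)‖ < 1 := by
    intro ψ hψJ
    let w : EE k := WithLp.toLp 2 (fun i => ψ ⟨c i, Subalgebra.le_topologicalClosure _
      ⟨MvPolynomial.X i, by simp⟩⟩)
    obtain ⟨hψle, hψc⟩ := char_bound (A := A) (by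
      change ‖(1 : C(K, ℂ))‖ ≤ 1
      rw [ContinuousMap.norm_le _ zero_le_one]
      simp) ψ
    have hψP : ∀ P, ψ (pol P) = MvPolynomial.eval (fun i => w i) P := by
      intro P
      induction P using MvPolynomial.induction_on with
      | C a =>
        have : pol (MvPolynomial.C a) = algebraMap ℂ A a := by
          apply Subtype.ext
          simp [pol]
        rw [this]; simp
      | add p q hp hq =>
        have : pol (p + q) = pol p + pol q := by
          apply Subtype.ext
          simp [pol]
        rw [this, map_add, hp, hq, map_add]
      | mul_X p i hp =>
        have : pol (p * MvPolynomial.X i) = pol p * ⟨c i, Subalgebra.le_topologicalClosure _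
            ⟨MvPolynomial.X i, by simp⟩⟩ := by
          apply Subtype.ext
          simp [pol]
        rw [this, map_mul, hp, map_mul, MvPolynomial.eval_X]
    have hwK : w ∈ K := by
      rw [← hKpc]
      intro P
      rw [← hψP]
      refine (hψle _).trans ?_
      change ‖(pol P).1‖ ≤ _
      rw [ContinuousMap.norm_eq_iSup_norm]
      simp only [hpol]
      exact le_rfl
    have hψa : ∀ a : A, ψ a = a.1 ⟨w, hwK⟩ := by
      have hcl : IsClosed {a : A | ψ a = a.1 ⟨w, hwK⟩} :=
        isClosed_eq hψc ((ContinuousMap.evalCLM ℂ (⟨w, hwK⟩ : K)).continuous.comp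
          continuous_subtype_val)
      intro a
      have : closure (range pol) ⊆ {a : A | ψ a = a.1 ⟨w, hwK⟩} := by
        apply hcl.closure_subset_iff.2
        rintro _ ⟨P, rfl⟩
        simp only [Set.mem_ofPred_eq]
        rw [hψP, hpol]
      exact this (hdense a)
    have hw0 : ∀ f ∈ S, f w = 0 := by
      intro f hf
      have h1 : ψ (res f (hS f hf)) = f w := hψa _
      rw [← h1]
      exact hψJ _ (subset_closure ⟨f, hS f hf, fun w hw => hw f hf, rfl⟩)
    have := hQ w hwK hw0
    rw [← hψP] at this
    exact this
  obtain ⟨n, hn0, r, hj, hr2⟩ := pow_quot J hJ (pol Q) hchar (ε / 2) (half_pos hε)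
  replace hj : pol Q ^ n - r ∈ closure G := hj
  obtain ⟨_, ⟨g, hg, hg0, rfl⟩, hgd⟩ := Metric.mem_closure_iff.1 hj (ε / 2) (half_pos hε)
  refine ⟨n, g, hn0, hg, hg0, fun x hx => ?_⟩
  have h1 : ‖pol Q ^ n - res g hg‖ < ε := by
    rw [dist_eq_norm] at hgd
    calc ‖pol Q ^ n - res g hg‖ = ‖(pol Q ^ n - r - res g hg) + r‖ := by congr 1; abel
      _ ≤ ‖pol Q ^ n - r - res g hg‖ + ‖r‖ := norm_add_le _ _
      _ < ε := by linarith
  have h2 := (ContinuousMap.norm_coe_le_norm (pol Q ^ n - res g hg).1 (⟨x, hx⟩ : K)).trans_lt h1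
  have h3 : (pol Q ^ n - res g hg).1 (⟨x, hx⟩ : K) =
      MvPolynomial.eval (fun i => x i) Q ^ n - g x := by
    have : (pol Q ^ n - res g hg).1 (⟨x, hx⟩ : K) = (pol Q).1 (⟨x, hx⟩ : K) ^ n - g x := rfl
    rw [this, hpol]
  rw [h3] at h2
  exact h2

theorem hull_of_union_with_compact_in_variety (k : ℕ) (hk : 2 ≤ k)
    (K : Set (EuclideanSpace ℂ (Fin k))) (hK : IsCompact K) (hKpc : polyHull k K = K)
    (V : Set (EuclideanSpace ℂ (Fin k)))
    (hV : ∃ S : Set (EuclideanSpace ℂ (Fin k) → ℂ),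
      (∀ f ∈ S, Differentiable ℂ f) ∧ V = {z | ∀ f ∈ S, f z = 0})
    (K' : Set (EuclideanSpace ℂ (Fin k))) (hK' : IsCompact K') (hK'V : K' ⊆ V)
    (hKV : K ∩ V ⊆ K') :
    polyHull k (K ∪ K') = K ∪ polyHull k K' := by
  obtain ⟨S, hS, rfl⟩ := hV
  have hKK : IsCompact (K ∪ K') := hK.union hK'
  apply Subset.antisymm
  swap
  · apply union_subset
    · exact subset_union_left.trans (subset_polyHull _ hKK)
    · exact polyHull_mono _ _ hKK subset_union_right
  intro z hz
  by_contra hcon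
  rw [mem_union, not_or] at hcon
  obtain ⟨hzK, hzK'⟩ := hcon
  by_cases hzV : ∀ f ∈ S, f z = 0
  · obtain ⟨Q, r, hr0, hr1, hQz, hQ⟩ := exists_sep K' hK' z hzK'
    obtain ⟨n, g, hn, hg, hg0, hgK⟩ := key K hK hKpc S hS Q
      (fun w hw hw0 => (hQ w (hKV ⟨hw, hw0⟩)).trans_lt hr1) (1 / 2) (by norm_num)
    have := hull_entire (K ∪ K') hKK z hz
      (fun x => MvPolynomial.eval (fun i => x i) Q ^ n - g x)
      (((differentiable_poly Q).pow n).sub hg) (max (1 / 2) r) (by positivity) (by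
        rintro x (hx | hx)
        · exact (hgK x hx).le.trans (le_max_left _ _)
        · simp only [hg0 x (hK'V hx), sub_zero, norm_pow]
          refine le_trans ?_ (le_max_right _ _)
          calc _ ≤ r ^ n := pow_le_pow_left₀ (norm_nonneg _) (hQ x hx) n
            _ ≤ r := pow_le_of_le_one hr0 hr1.le hn.ne')
    simp only [hQz, hg0 z hzV, one_pow, sub_zero, norm_one] at this
    rcases le_max_iff.1 this with h | h
    · norm_num at h
    · linarith
  · push Not at hzV
    obtain ⟨f, hfS, hfz⟩ := hzV
    rw [← hKpc] at hzK
    obtain ⟨Q, r, hr0, hr1, hQz, hQ⟩ := exists_sep K hK z hzK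
    obtain ⟨M, hM⟩ := (hK.image (hS f hfS).continuous.norm).bddAbove
    have hlim : Tendsto (fun n : ℕ => r ^ n * |M|) atTop (nhds (0 * |M|)) :=
      (tendsto_pow_atTop_nhds_zero_of_lt_one hr0 hr1).mul_const _
    rw [zero_mul] at hlim
    obtain ⟨n, hn⟩ := (hlim.eventually (gt_mem_nhds (norm_pos_iff.2 hfz))).exists
    have := hull_entire (K ∪ K') hKK z hz
      (fun x => MvPolynomial.eval (fun i => x i) Q ^ n * f x)
      (((differentiable_poly Q).pow n).mul (hS f hfS)) (r ^ n * |M|) (by positivity) (by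
        rintro x (hx | hx)
        · simp only [norm_mul, norm_pow]
          gcongr
          · exact hQ x hx
          · exact (hM ⟨x, hx, rfl⟩).trans (le_abs_self M)
        · simp only [hK'V hx f hfS, mul_zero, norm_zero]
          positivity)
    simp only [hQz, one_pow, one_mul] at this
    linarith
end
end

section
/- Let K ⊆ ℂ be a compact polynomially convex set, let p₁, p₂ ∈ K, and let Q = {q₁, …, q_m} be a finite subset of ℂ \ K. Then there exists a compact polynomially convex set K' ⊆ ℂ with K ⊆ K', such that p₁ and p₂ lie in the same path-connected component of K' (i.e. there is a continuous path in K' joining p₁ to p₂), and Q ∩ K' = ∅. -/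
open Metric Set Filter

noncomputable section

/-- The polynomially convex hull of a set `K ⊆ ℂ`: the points `z` with
`|P(z)| ≤ sup_K |P|` for every polynomial `P`. -/
def polyHullC (K : Set ℂ) : Set ℂ :=
  {z | ∀ P : Polynomial ℂ, ‖P.eval z‖ ≤ ⨆ w : K, ‖P.eval (w : ℂ)‖}

lemma push_homeo (c w : ℂ) (r : ℝ) (h : ‖w - c‖ < r) :
    ∃ f : ℂ ≃ₜ ℂ, f c = w ∧ ∀ z, z ∉ ball c r → f z = z := by
  have hr : 0 < r := lt_of_le_of_lt (norm_nonneg _) h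
  let g : ℂ → ℂ := fun z => z + ((max 0 (1 - ‖z - c‖ / r) : ℝ) : ℂ) * (w - c)
  let k : NNReal := ⟨‖w - c‖ / r, by positivity⟩
  have hk : (k : ℝ) = ‖w - c‖ / r := rfl
  have hk1 : (k : ℝ) < 1 := by rw [hk, div_lt_one hr]; exact h
  have happ : ApproximatesLinearOn g
      ((ContinuousLinearEquiv.refl ℂ ℂ : ℂ ≃L[ℂ] ℂ) : ℂ →L[ℂ] ℂ) univ k := by
    intro x _ y _
    have e : g x - g y - ((ContinuousLinearEquiv.refl ℂ ℂ : ℂ ≃L[ℂ] ℂ) : ℂ →L[ℂ] ℂ) (x - y)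
        = ((max 0 (1 - ‖x - c‖ / r) - max 0 (1 - ‖y - c‖ / r) : ℝ) : ℂ) * (w - c) := by
      simp only [g, ContinuousLinearEquiv.coe_coe, ContinuousLinearEquiv.refl_apply]
      push_cast
      ring
    rw [e, norm_mul, Complex.norm_real, hk, Real.norm_eq_abs]
    have h1 : |max 0 (1 - ‖x - c‖ / r) - max 0 (1 - ‖y - c‖ / r)| ≤ ‖x - y‖ / r := by
      rw [max_comm 0, max_comm 0]
      refine (abs_max_sub_max_le_abs _ _ _).trans ?_
      have : (1 - ‖x - c‖ / r) - (1 - ‖y - c‖ / r) = (‖y - c‖ - ‖x - c‖) / r := by ring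
      rw [this, abs_div, abs_of_pos hr]
      gcongr
      refine (abs_norm_sub_norm_le _ _).trans ?_
      rw [sub_sub_sub_cancel_right, norm_sub_rev]
    calc _ ≤ ‖x - y‖ / r * ‖w - c‖ := by gcongr
      _ = _ := by ring
  have hc : Subsingleton ℂ ∨
      k < ‖((ContinuousLinearEquiv.refl ℂ ℂ : ℂ ≃L[ℂ] ℂ).symm : ℂ →L[ℂ] ℂ)‖₊⁻¹ := by
    right
    have : ‖((ContinuousLinearEquiv.refl ℂ ℂ : ℂ ≃L[ℂ] ℂ).symm : ℂ →L[ℂ] ℂ)‖₊ = 1 := by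
      have : ((ContinuousLinearEquiv.refl ℂ ℂ : ℂ ≃L[ℂ] ℂ).symm : ℂ →L[ℂ] ℂ)
        = ContinuousLinearMap.id ℂ ℂ := by ext; simp
      rw [this]
      simp
    rw [this, inv_one]
    exact_mod_cast hk1
  refine ⟨happ.toHomeomorph g hc, ?_, ?_⟩
  · change g c = w
    simp [g]
  · intro z hz
    change g z = z
    have : 1 - ‖z - c‖ / r ≤ 0 := by
      rw [sub_nonpos, one_le_div hr]
      simpa [dist_eq_norm] using hz
    simp [g, max_eq_left this]

lemma bdd_poly {K : Set ℂ} (hK : IsCompact K) (P : Polynomial ℂ) :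
    BddAbove (range fun w : K => ‖P.eval (w : ℂ)‖) := by
  have := (hK.image (f := fun w => ‖P.eval w‖) (by fun_prop)).bddAbove
  rwa [image_eq_range] at this

lemma subset_hull {K : Set ℂ} (hK : IsCompact K) : K ⊆ polyHullC K :=
  fun z hz P => le_ciSup (bdd_poly hK P) ⟨z, hz⟩

lemma push_far {K : Set ℂ} (hK : IsCompact K) (hKpc : polyHullC K = K) (hne : K.Nonempty)
    (R : ℝ) (q : ℂ) (hq : q ∉ K) :
    ∃ f : ℂ ≃ₜ ℂ, (∀ z ∈ K, f z = z) ∧ f q ∉ closedBall (0 : ℂ) R := by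
  by_contra! hcon
  let S : Set ℂ := {z | ∃ f : ℂ ≃ₜ ℂ, (∀ z ∈ K, f z = z) ∧ f q = z}
  have hSb : Bornology.IsBounded S := by
    refine (isBounded_closedBall (x := (0 : ℂ)) (r := R)).subset ?_
    rintro z ⟨f, hf, rfl⟩
    exact hcon f hf
  have hqS : q ∈ S := ⟨Homeomorph.refl ℂ, fun _ _ => rfl, rfl⟩
  have hfr : frontier S ⊆ K := by
    intro z hz
    by_contra hzK
    obtain ⟨r, hr, hball⟩ := Metric.isOpen_iff.1 hK.isClosed.isOpen_compl z hzK
    have hout : ∀ x ∈ K, x ∉ ball z r := fun x hx hxb => hball hxb hx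
    have hzS : z ∈ S := by
      obtain ⟨s, ⟨f, hf, hfs⟩, hs⟩ := Metric.mem_closure_iff.1 hz.1 r hr
      obtain ⟨g, hg1, hg2⟩ := push_homeo z s r (by rwa [← dist_eq_norm, dist_comm])
      refine ⟨f.trans g.symm, fun x hx => ?_, ?_⟩
      · simp only [Homeomorph.trans_apply, hf x hx]
        rw [Homeomorph.symm_apply_eq, hg2 x (hout x hx)]
      · simp only [Homeomorph.trans_apply, hfs]
        rw [Homeomorph.symm_apply_eq, hg1]
    apply hz.2
    rw [mem_interior_iff_mem_nhds]
    refine Filter.mem_of_superset (ball_mem_nhds z hr) ?_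
    intro s hs
    obtain ⟨f, hf, hfs⟩ := hzS
    obtain ⟨g, hg1, hg2⟩ := push_homeo z s r (by rwa [← dist_eq_norm])
    refine ⟨f.trans g, fun x hx => ?_, ?_⟩
    · simp only [Homeomorph.trans_apply, hf x hx]
      exact hg2 x (hout x hx)
    · simp only [Homeomorph.trans_apply, hfs, hg1]
  apply hq
  rw [← hKpc]
  intro P
  refine Complex.norm_le_of_forall_mem_frontier_norm_le (f := fun z => P.eval z) hSb
    (Differentiable.diffContOnCl P.differentiable) ?_ (subset_closure hqS)
  intro z hz
  exact le_ciSup (bdd_poly hK P) ⟨z, hfr hz⟩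

lemma exists_poly {K : Set ℂ} (hne : K.Nonempty) (z : ℂ)
    (hz : z ∉ polyHullC K) (hK : IsCompact K) :
    ∃ P : Polynomial ℂ, ∃ M : ℝ, 0 ≤ M ∧ M < ‖P.eval z‖ ∧ ∀ w ∈ K, ‖P.eval w‖ ≤ M := by
  simp only [polyHullC, mem_setOf_eq, not_forall, not_le] at hz
  obtain ⟨P, hP⟩ := hz
  exact ⟨P, _, Real.iSup_nonneg fun _ => norm_nonneg _, hP,
    fun w hw => le_ciSup (bdd_poly hK P) ⟨w, hw⟩⟩

lemma pc_insert {K : Set ℂ} (hK : IsCompact K) (hKpc : polyHullC K = K) (hne : K.Nonempty)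
    (a : ℂ) : polyHullC (insert a K) = insert a K := by
  refine Subset.antisymm ?_ (subset_hull (hK.insert a))
  intro z hz
  by_contra hzn
  rw [mem_insert_iff, not_or] at hzn
  obtain ⟨P, M, hM0, hM, hPM⟩ := exists_poly hne z (by rw [hKpc]; exact hzn.2) hK
  have hPz : 0 < ‖P.eval z‖ := hM0.trans_lt hM
  obtain ⟨B, hB⟩ := (hK.image (f := fun w => ‖w - a‖) (by fun_prop)).bddAbove
  have hB' : ∀ w ∈ K, ‖w - a‖ ≤ B := fun w hw => hB ⟨w, hw, rfl⟩
  have hB0 : 0 ≤ B := by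
    obtain ⟨w, hw⟩ := hne
    exact (norm_nonneg _).trans (hB' w hw)
  have hza : 0 < ‖z - a‖ := norm_pos_iff.2 (sub_ne_zero.2 hzn.1)
  obtain ⟨n, hn⟩ := exists_pow_lt_of_lt_one (show 0 < ‖z - a‖ / (B + 1) by positivity)
    ((div_lt_one hPz).2 hM)
  have key := hz (P ^ n * (Polynomial.X - Polynomial.C a))
  have : (⨆ w : (insert a K : Set ℂ),
      ‖(P ^ n * (Polynomial.X - Polynomial.C a)).eval (w : ℂ)‖) ≤ M ^ n * B := by
    have : Nonempty (insert a K : Set ℂ) := ⟨⟨a, mem_insert _ _⟩⟩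
    refine ciSup_le ?_
    rintro ⟨w, rfl | hw⟩
    · simp; positivity
    · simp only [Polynomial.eval_mul, Polynomial.eval_pow, Polynomial.eval_sub,
        Polynomial.eval_X, Polynomial.eval_C, norm_mul, norm_pow]
      gcongr
      · exact hPM w hw
      · exact hB' w hw
  have key2 := key.trans this
  simp only [Polynomial.eval_mul, Polynomial.eval_pow, Polynomial.eval_sub,
        Polynomial.eval_X, Polynomial.eval_C, norm_mul, norm_pow] at key2
  rw [div_pow, div_lt_div_iff₀ (by positivity) (by positivity)] at hn
  have : 0 ≤ M ^ n := by positivity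
  nlinarith

lemma pc_union {K : Set ℂ} (hK : IsCompact K) (hKpc : polyHullC K = K) (hne : K.Nonempty)
    (F : Finset ℂ) : polyHullC (K ∪ F) = K ∪ F := by
  classical
  induction F using Finset.induction_on with
  | empty => simpa using hKpc
  | insert a F _ ih =>
    rw [Finset.coe_insert, union_insert]
    exact pc_insert (hK.union F.finite_toSet.isCompact) ih (hne.mono subset_union_left) a

lemma push_all {K : Set ℂ} (hK : IsCompact K) (hKpc : polyHullC K = K) (hne : K.Nonempty)
    (R : ℝ) (Q : Finset ℂ) : (∀ q ∈ Q, q ∉ K) →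
    ∃ f : ℂ ≃ₜ ℂ, (∀ z ∈ K, f z = z) ∧ ∀ q ∈ Q, f q ∉ closedBall (0 : ℂ) R := by
  classical
  induction Q using Finset.induction_on with
  | empty => exact fun _ => ⟨Homeomorph.refl ℂ, fun _ _ => rfl, by simp⟩
  | insert a F ha ih =>
    intro hQ
    obtain ⟨f, hf, hfF⟩ := ih fun q hq => hQ q (Finset.mem_insert_of_mem hq)
    have hfa : f a ∉ K ∪ (F.image f : Finset ℂ) := by
      rintro (h | h)
      · have h2 : f (f a) = f a := hf _ h
        have := f.injective h2
        rw [this] at h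
        exact hQ a (Finset.mem_insert_self _ _) h
      · simp only [Finset.coe_image, mem_image, Finset.mem_coe] at h
        obtain ⟨x, hx, hxa⟩ := h
        exact ha (f.injective hxa ▸ hx)
    obtain ⟨g, hg, hga⟩ := push_far (hK.union (F.image f).finite_toSet.isCompact)
      (pc_union hK hKpc hne _) (hne.mono subset_union_left) R (f a) hfa
    refine ⟨f.trans g, fun z hz => ?_, fun q hq => ?_⟩
    · simp only [Homeomorph.trans_apply, hf z hz]
      exact hg z (Or.inl hz)
    · rcases Finset.mem_insert.1 hq with rfl | hq
      · exact hga
      · rw [Homeomorph.trans_apply, hg (f q) (Or.inr (by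
          simp only [Finset.coe_image]; exact mem_image_of_mem f hq))]
        exact hfF q hq

lemma preconn_compl_closedBall (R : ℝ) (hR : 0 < R) :
    IsPreconnected (closedBall (0 : ℂ) R)ᶜ := by
  have : (closedBall (0 : ℂ) R)ᶜ = Complex.exp '' {w | Real.log R < w.re} := by
    ext z
    simp only [mem_compl_iff, mem_closedBall, dist_zero_right, not_le, mem_image, mem_setOf_eq]
    constructor
    · intro h
      have hz : z ≠ 0 := by rintro rfl; simp at h; linarith
      refine ⟨Complex.log z, ?_, Complex.exp_log hz⟩
      rw [Complex.log_re]
      exact Real.log_lt_log hR h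
    · rintro ⟨w, hw, rfl⟩
      rw [Complex.norm_exp]
      exact (Real.log_lt_iff_lt_exp hR).1 hw
  rw [this]
  exact (convex_halfSpace_re_gt _).isPreconnected.image _ Complex.continuous_exp.continuousOn

lemma pc_of_preconn {L : Set ℂ} (hL : IsCompact L) (hne : L.Nonempty)
    (hc : IsPreconnected Lᶜ) : polyHullC L = L := by
  refine Subset.antisymm ?_ (subset_hull hL)
  intro q hq
  by_contra hqL
  have : CompactSpace L := isCompact_iff_compactSpace.1 hL
  have : Nonempty L := hne.to_subtype
  let S : Subalgebra ℂ C(L, ℂ) := (polynomialFunctions L).topologicalClosure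
  have hS : IsClosed (S : Set C(L, ℂ)) := Subalgebra.isClosed_topologicalClosure _
  have hXS : (Polynomial.X : Polynomial ℂ).toContinuousMapOn L ∈ S := by
    apply Subalgebra.le_topologicalClosure
    rw [← SetLike.mem_coe, polynomialFunctions_coe]
    exact ⟨Polynomial.X, rfl⟩
  let x : S := ⟨_, hXS⟩
  have hsp : spectrum ℂ (x : C(L, ℂ)) = L := by
    rw [ContinuousMap.spectrum_eq_range]
    ext z
    simp [x]
  have : IsClosed (S : Set C(L, ℂ)) := hS
  have hsp2 : spectrum ℂ x = L := by
    rw [Subalgebra.spectrum_eq_of_isPreconnected_compl S x (by rw [hsp]; exact hc), hsp]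
  have hu : q ∉ spectrum ℂ x := by rw [hsp2]; exact hqL
  rw [spectrum.notMem_iff] at hu
  obtain ⟨y, hy⟩ := hu.exists_right_inv
  have hyS : (y : C(L, ℂ)) ∈ closure (polynomialFunctions L : Set C(L, ℂ)) := y.2
  obtain ⟨B, hB⟩ := (hL.image (f := fun w => ‖q - w‖) (by fun_prop)).bddAbove
  have hB' : ∀ w ∈ L, ‖q - w‖ ≤ B := fun w hw => hB ⟨w, hw, rfl⟩
  have hB0 : 0 ≤ B := by
    obtain ⟨w, hw⟩ := hne
    exact (norm_nonneg _).trans (hB' w hw)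
  obtain ⟨p, hp, hpd⟩ := Metric.mem_closure_iff.1 hyS (1 / (2 * (B + 1))) (by positivity)
  rw [polynomialFunctions_coe] at hp
  obtain ⟨P, rfl⟩ := hp
  have key := hq (1 - (Polynomial.C q - Polynomial.X) * P)
  have hle : (⨆ w : L, ‖(1 - (Polynomial.C q - Polynomial.X) * P).eval (w : ℂ)‖) ≤ 1 / 2 := by
    refine ciSup_le fun w => ?_
    have h1 : (q - (w : ℂ)) * (y : C(L, ℂ)) w = 1 := by
      have := congrArg (fun s : S => (s : C(L, ℂ)) w) hy
      simpa [x] using this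
    have h2 : ‖(y : C(L, ℂ)) w - P.eval (w : ℂ)‖ ≤ 1 / (2 * (B + 1)) := by
      have := (ContinuousMap.dist_apply_le_dist (f := (y : C(L, ℂ)))
        (g := Polynomial.toContinuousMapOnAlgHom L P) w).trans hpd.le
      rw [dist_eq_norm] at this
      simpa using this
    have h3 : (1 - (Polynomial.C q - Polynomial.X) * P).eval (w : ℂ)
        = (q - (w : ℂ)) * ((y : C(L, ℂ)) w - P.eval (w : ℂ)) := by
      simp only [Polynomial.eval_mul, Polynomial.eval_one, Polynomial.eval_sub,
        Polynomial.eval_X, Polynomial.eval_C]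
      rw [mul_sub, h1]
    rw [h3, norm_mul]
    calc _ ≤ B * (1 / (2 * (B + 1))) := by gcongr; exact hB' w w.2
      _ ≤ 1 / 2 := by
        rw [mul_one_div, div_le_div_iff₀ (by positivity) (by positivity)]
        linarith
  have := key.trans hle
  simp at this
  norm_num at this

theorem connecting_points_in_polynomially_convex_sets
    (K : Set ℂ) (hK : IsCompact K) (hKpc : polyHullC K = K)
    (p₁ p₂ : ℂ) (hp₁ : p₁ ∈ K) (hp₂ : p₂ ∈ K)
    (Q : Finset ℂ) (hQ : ∀ q ∈ Q, q ∉ K) :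
    ∃ K' : Set ℂ, IsCompact K' ∧ polyHullC K' = K' ∧ K ⊆ K' ∧
      JoinedIn K' p₁ p₂ ∧ ∀ q ∈ Q, q ∉ K' := by
  obtain ⟨R, hR, hKR⟩ := hK.isBounded.subset_closedBall_lt 0 (0 : ℂ)
  obtain ⟨f, hf, hfQ⟩ := push_all hK hKpc ⟨p₁, hp₁⟩ R Q hQ
  have himg : f ⁻¹' (closedBall (0 : ℂ) R) = f.symm '' (closedBall (0 : ℂ) R) :=
    (f.image_symm ▸ rfl)
  have hcomp : IsCompact (f ⁻¹' (closedBall (0 : ℂ) R)) := by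
    rw [himg]
    exact (isCompact_closedBall _ _).image f.symm.continuous
  have hsub : K ⊆ f ⁻¹' (closedBall (0 : ℂ) R) := by
    intro z hz
    rw [mem_preimage, hf z hz]
    exact hKR hz
  refine ⟨f ⁻¹' (closedBall (0 : ℂ) R), hcomp, ?_, hsub, ?_, fun q hq => hfQ q hq⟩
  · refine pc_of_preconn hcomp ⟨p₁, hsub hp₁⟩ ?_
    rw [← preimage_compl, ← f.image_symm]
    exact (preconn_compl_closedBall R hR).image _ f.symm.continuous.continuousOn
  · have hpc : IsPathConnected (f ⁻¹' (closedBall (0 : ℂ) R)) := by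
      rw [himg]
      exact ((convex_closedBall (0 : ℂ) R).isPathConnected
        ⟨0, by simp [hR.le]⟩).image f.symm.continuous
    exact hpc.joinedIn p₁ (hsub hp₁) p₂ (hsub hp₂)
end
end
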